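/- arXiv:math/0203177 — 7 statements merged into one kernel-verified Lean document; each statement's English description precedes it below -/
import Mathlib

section
/- Let (x,y)∈Λ_2. Then for every n∈ℕ: (i) (x⊓y)(n)+(y⊔x)(n)=x(n)+y(n); (ii) x(n)−(x⊓y)(n)=max_{0≤m≤n}[(x(n)−x(m))−(y(n)−y(m))]; and (iii) if in addition sup_{n∈ℕ}(y(n)−x(n))=+∞, then x(n)−(x⊓y)(n)=sup_{l≥n}[((x⊓y)(l)−(x⊓y)(n))−((y⊔x)(l)−(y⊔x)(n))], and this supremum is attained at some l≥n. -/
noncomputable def minOp (x y : ℕ → ℤ) : ℕ → ℤ := fun n =>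
  Finset.inf' (Finset.range (n+1)) (by simp) (fun m => x m + y n - y m)

noncomputable def maxOp (x y : ℕ → ℤ) : ℕ → ℤ := fun n =>
  Finset.sup' (Finset.range (n+1)) (by simp) (fun m => x m + y n - y m)

theorem minOp_le_aux (x y : ℕ → ℤ) (n k : ℕ) (h : k ≤ n) :
    minOp x y n ≤ x k + y n - y k :=
  Finset.inf'_le (fun m => x m + y n - y m) (by simp; omega)

theorem minOp_ex_aux (x y : ℕ → ℤ) (n : ℕ) :
    ∃ k, k ≤ n ∧ minOp x y n = x k + y n - y k := by
  obtain ⟨k, hk, h⟩ := Finset.exists_mem_eq_inf' (s := Finset.range (n+1)) (by simp)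
    (fun m => x m + y n - y m)
  exact ⟨k, by simp at hk; omega, h⟩

theorem maxOp_aux (x y : ℕ → ℤ) (n : ℕ) :
    minOp x y n + maxOp y x n = x n + y n := by
  obtain ⟨k, hk, h⟩ := minOp_ex_aux x y n
  have h1 : maxOp y x n = x n + y n - minOp x y n := by
    apply le_antisymm
    · apply Finset.sup'_le
      intro b hb
      have := minOp_le_aux x y n b (by simp at hb; omega)
      linarith
    · have : y k + x n - x k ≤ maxOp y x n :=
        Finset.le_sup' (fun m => y m + x n - x m) (by simp; omega)
      linarith
  linarith

theorem hit_aux (x y : ℕ → ℤ)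
    (hstep : ∀ n, (x (n+1) = x n ∧ y (n+1) = y n) ∨
                  (x (n+1) = x n + 1 ∧ y (n+1) = y n) ∨
                  (x (n+1) = x n ∧ y (n+1) = y n + 1)) (n : ℕ) (j : ℕ) :
    (∃ l, n ≤ l ∧ x l - y l = minOp x y n - y n ∧ minOp x y l - y l = minOp x y n - y n) ∨
    (∀ k, k ≤ n + j → n ≤ k → minOp x y n - y n < x k - y k) := by
  by_contra! hc
  obtain ⟨hno, k, hk1, hk2, hk3⟩ := hc
  have hex : ∃ l, n ≤ l ∧ x l - y l ≤ minOp x y n - y n := ⟨k, hk2, hk3⟩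
  classical
  obtain ⟨hl1, hl2⟩ := Nat.find_spec hex
  have hmin := fun m => Nat.find_min (m := m) hex
  generalize Nat.find hex = l at *
  have hA : ∀ b, b < l → minOp x y n - y n ≤ x b - y b := by
    intro b hb
    by_cases hbn : b ≤ n
    · have := minOp_le_aux x y n b hbn
      linarith
    · have := hmin b hb
      by_contra hcc
      exact this ⟨by omega, by linarith⟩
  have hd : x l - y l = minOp x y n - y n := by
    rcases Nat.eq_or_lt_of_le hl1 with h | h
    · subst h
      have := minOp_le_aux x y n n le_rfl
      linarith
    · obtain ⟨p, rfl⟩ : ∃ p, l = p + 1 := ⟨l - 1, by omega⟩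
      have h2 := hmin p (by omega)
      have h3 : minOp x y n - y n < x p - y p := by
        by_contra hcc
        exact h2 ⟨by omega, by linarith⟩
      rcases hstep p with h | h | h <;> omega
  apply hno l hl1 hd
  obtain ⟨b, hb, hbe⟩ := minOp_ex_aux x y l
  have h5 := minOp_le_aux x y l l le_rfl
  rcases Nat.eq_or_lt_of_le hb with h | h
  · subst h; linarith
  · have := hA b h
    linarith

/-- basic identities for the operations `⊓`, `⊔` on paths in `Λ_2`. -/
theorem stmt0 (x y : ℕ → ℤ)
    (h0 : x 0 = 0 ∧ y 0 = 0)
    (hstep : ∀ n, (x (n+1) = x n ∧ y (n+1) = y n) ∨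
                  (x (n+1) = x n + 1 ∧ y (n+1) = y n) ∨
                  (x (n+1) = x n ∧ y (n+1) = y n + 1)) :
    (∀ n, minOp x y n + maxOp y x n = x n + y n) ∧
    (∀ n, x n - minOp x y n =
      Finset.sup' (Finset.range (n+1)) (by simp)
        (fun m => (x n - x m) - (y n - y m))) ∧
    ((∀ M : ℤ, ∃ n, M < y n - x n) → ∀ n, ∃ l, n ≤ l ∧
      x n - minOp x y n =
        (minOp x y l - minOp x y n) - (maxOp y x l - maxOp y x n) ∧
      ∀ l', n ≤ l' →
        (minOp x y l' - minOp x y n) - (maxOp y x l' - maxOp y x n)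
          ≤ x n - minOp x y n) := by
  refine ⟨maxOp_aux x y, ?_, ?_⟩
  · intro n
    obtain ⟨k, hk, h⟩ := minOp_ex_aux x y n
    apply le_antisymm
    · have : (x n - x k) - (y n - y k) ≤ Finset.sup' (Finset.range (n+1)) (by simp)
        (fun m => (x n - x m) - (y n - y m)) :=
        Finset.le_sup' (fun m => (x n - x m) - (y n - y m)) (by simp; omega)
      linarith
    · apply Finset.sup'_le
      intro b hb
      have := minOp_le_aux x y n b (by simp at hb; omega)
      linarith
  · intro hinf n
    have hn := maxOp_aux x y n
    obtain ⟨N, hN⟩ := hinf (y n - minOp x y n)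
    rcases hit_aux x y hstep n N with ⟨l, hl, h1, h2⟩ | h
    · refine ⟨l, hl, ?_, ?_⟩
      · have := maxOp_aux x y l
        linarith
      · intro l' hl'
        have h3 := maxOp_aux x y l'
        have h4 := minOp_le_aux x y l' l' le_rfl
        obtain ⟨b, hb, hbe⟩ := minOp_ex_aux x y n
        have h5 := minOp_le_aux x y l' b (by omega)
        linarith
    · exfalso
      by_cases hc : n ≤ N
      · have := h N (by omega) hc
        linarith
      · have := minOp_le_aux x y n N (by omega)
        linarith
end

section
/- Let (a,b,c)∈Λ_3. Then, as identities of sequences (evaluating left to right where no parentheses are given): (a⊔(c⊓b))⊔(b⊔c) = (a⊔b)⊔c, and (a⊓(c⊔b))⊓(b⊓c) = (a⊓b)⊓c. -/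
/-- Membership in `Λ_k`: starts at the origin and at each step either stays put
or increases exactly one of the first `k` coordinates by `1`. -/
def IsLambdaPath (k : ℕ) (x : ℕ → ℕ → ℤ) : Prop :=
  (∀ i, i < k → x i 0 = 0) ∧
  ∀ n, (∀ i, i < k → x i (n+1) = x i n) ∨
    ∃ j, j < k ∧ x j (n+1) = x j n + 1 ∧ ∀ i, i < k → i ≠ j → x i (n+1) = x i n

theorem minOp_zero (x y : ℕ → ℤ) : minOp x y 0 = x 0 := by
  simp [minOp]

theorem maxOp_zero (x y : ℕ → ℤ) : maxOp x y 0 = x 0 := by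
  simp [maxOp]

theorem minOp_succ (x y : ℕ → ℤ) (n : ℕ) :
    minOp x y (n+1) = min (minOp x y n + (y (n+1) - y n)) (x (n+1)) := by
  apply eq_of_forall_le_iff
  intro d
  have e : d ≤ minOp x y n + (y (n+1) - y n) ↔ d - (y (n+1) - y n) ≤ minOp x y n := by omega
  rw [le_min_iff, e]
  simp only [minOp, Finset.le_inf'_iff, Finset.mem_range]
  constructor
  · intro h
    refine ⟨fun m hm => ?_, ?_⟩
    · have := h m (by omega)
      omega
    · have := h (n+1) (by omega)
      omega
  · rintro ⟨h1, h2⟩ m hm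
    rcases Nat.lt_succ_iff_lt_or_eq.mp hm with h | rfl
    · have := h1 m h
      omega
    · omega

theorem maxOp_succ (x y : ℕ → ℤ) (n : ℕ) :
    maxOp x y (n+1) = max (maxOp x y n + (y (n+1) - y n)) (x (n+1)) := by
  apply eq_of_forall_ge_iff
  intro d
  have e : maxOp x y n + (y (n+1) - y n) ≤ d ↔ maxOp x y n ≤ d - (y (n+1) - y n) := by omega
  rw [max_le_iff, e]
  simp only [maxOp, Finset.sup'_le_iff, Finset.mem_range]
  constructor
  · intro h
    refine ⟨fun m hm => ?_, ?_⟩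
    · have := h m (by omega)
      omega
    · have := h (n+1) (by omega)
      omega
  · rintro ⟨h1, h2⟩ m hm
    rcases Nat.lt_succ_iff_lt_or_eq.mp hm with h | rfl
    · have := h1 m h
      omega
    · omega

theorem le_maxOp (x y : ℕ → ℤ) (n : ℕ) : x n ≤ maxOp x y n := by
  cases n with
  | zero => rw [maxOp_zero]
  | succ n => rw [maxOp_succ]; exact le_max_right _ _

theorem minOp_le (x y : ℕ → ℤ) (n : ℕ) : minOp x y n ≤ x n := by
  cases n with
  | zero => rw [minOp_zero]
  | succ n => rw [minOp_succ]; exact min_le_right _ _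

theorem stmt3_steps (a b c : ℕ → ℤ)
    (h : IsLambdaPath 3 (fun i => if i = 0 then a else if i = 1 then b else c)) :
    (a 0 = 0 ∧ b 0 = 0 ∧ c 0 = 0) ∧ ∀ n,
      (a (n+1) = a n ∧ b (n+1) = b n ∧ c (n+1) = c n) ∨
      (a (n+1) = a n + 1 ∧ b (n+1) = b n ∧ c (n+1) = c n) ∨
      (a (n+1) = a n ∧ b (n+1) = b n + 1 ∧ c (n+1) = c n) ∨
      (a (n+1) = a n ∧ b (n+1) = b n ∧ c (n+1) = c n + 1) := by
  obtain ⟨h0, h1⟩ := h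
  have z0 := h0 0 (by omega)
  have z1 := h0 1 (by omega)
  have z2 := h0 2 (by omega)
  simp at z0 z1 z2
  refine ⟨⟨z0, z1, z2⟩, fun n => ?_⟩
  rcases h1 n with h | ⟨j, hj, hh, h⟩
  · have z0 := h 0 (by omega)
    have z1 := h 1 (by omega)
    have z2 := h 2 (by omega)
    simp at z0 z1 z2
    omega
  · have z0 := h 0 (by omega)
    have z1 := h 1 (by omega)
    have z2 := h 2 (by omega)
    interval_cases j <;> simp at z0 z1 z2 hh <;> omega

theorem stmt3_max (a b c : ℕ → ℤ)
    (h : IsLambdaPath 3 (fun i => if i = 0 then a else if i = 1 then b else c)) (n : ℕ) :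
    maxOp (maxOp a (minOp c b)) (maxOp b c) n = maxOp (maxOp a b) c n ∧
    minOp c b n + maxOp b c n = b n + c n ∧
    maxOp (maxOp a b) c n - maxOp a b n =
      min (maxOp (maxOp a (minOp c b)) (maxOp b c) n - maxOp a (minOp c b) n)
        (maxOp b c n - b n) := by
  obtain ⟨⟨a0, b0, c0⟩, hs⟩ := stmt3_steps a b c h
  induction n with
  | zero => simp [maxOp_zero, minOp_zero, a0, b0, c0]
  | succ n ih =>
    have g1 := le_maxOp (maxOp a (minOp c b)) (maxOp b c) n
    have g2 := le_maxOp a (minOp c b) n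
    have g3 := le_maxOp b c n
    have g4 := le_maxOp (maxOp a b) c n
    have g5 := le_maxOp a b n
    have g6 := minOp_le c b n
    simp only [maxOp_succ, minOp_succ]
    generalize maxOp (maxOp a (minOp c b)) (maxOp b c) n = s at *
    generalize maxOp (maxOp a b) c n = u at *
    generalize maxOp a (minOp c b) n = r at *
    generalize maxOp a b n = t at *
    generalize maxOp b c n = q at *
    generalize minOp c b n = p at *
    rcases hs n with ⟨ha, hb, hc⟩ | ⟨ha, hb, hc⟩ | ⟨ha, hb, hc⟩ | ⟨ha, hb, hc⟩ <;>
      rw [ha, hb, hc] <;> omega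

theorem stmt3_min (a b c : ℕ → ℤ)
    (h : IsLambdaPath 3 (fun i => if i = 0 then a else if i = 1 then b else c)) (n : ℕ) :
    minOp (minOp a (maxOp c b)) (minOp b c) n = minOp (minOp a b) c n ∧
    maxOp c b n + minOp b c n = b n + c n ∧
    minOp a b n - minOp (minOp a b) c n =
      min (minOp a (maxOp c b) n - minOp (minOp a (maxOp c b)) (minOp b c) n)
        (b n - minOp b c n) := by
  obtain ⟨⟨a0, b0, c0⟩, hs⟩ := stmt3_steps a b c h
  induction n with
  | zero => simp [maxOp_zero, minOp_zero, a0, b0, c0]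
  | succ n ih =>
    have g1 := minOp_le (minOp a (maxOp c b)) (minOp b c) n
    have g2 := minOp_le a (maxOp c b) n
    have g3 := minOp_le b c n
    have g4 := minOp_le (minOp a b) c n
    have g5 := minOp_le a b n
    have g6 := le_maxOp c b n
    simp only [maxOp_succ, minOp_succ]
    generalize minOp (minOp a (maxOp c b)) (minOp b c) n = s at *
    generalize minOp (minOp a b) c n = u at *
    generalize minOp a (maxOp c b) n = r at *
    generalize minOp a b n = t at *
    generalize minOp b c n = q at *
    generalize maxOp c b n = p at *
    rcases hs n with ⟨ha, hb, hc⟩ | ⟨ha, hb, hc⟩ | ⟨ha, hb, hc⟩ | ⟨ha, hb, hc⟩ <;>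
      rw [ha, hb, hc] <;> omega

/-- for `(a,b,c) ∈ Λ_3`,
`a⊔(c⊓b)⊔(b⊔c) = a⊔b⊔c` and `a⊓(c⊔b)⊓(b⊓c) = a⊓b⊓c`. -/
theorem stmt3 (a b c : ℕ → ℤ)
    (h : IsLambdaPath 3 (fun i => if i = 0 then a else if i = 1 then b else c)) :
    maxOp (maxOp a (minOp c b)) (maxOp b c) = maxOp (maxOp a b) c ∧
    minOp (minOp a (maxOp c b)) (minOp b c) = minOp (minOp a b) c :=
  ⟨funext fun n => (stmt3_max a b c h n).1, funext fun n => (stmt3_min a b c h n).1⟩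
end

section
/- For every k≥2 and every x=(x_1,…,x_k)∈Λ_k, the last coordinate of the transformed path is given by the iterated max-operation: (G^{(k)}(x))_k = x_k⊔x_{k−1}⊔⋯⊔x_1 (evaluated left to right). -/
/-- `Dseq x i = x 0 ⊓ x 1 ⊓ ⋯ ⊓ x i` (left to right). -/
noncomputable def Dseq (x : ℕ → ℕ → ℤ) : ℕ → (ℕ → ℤ)
  | 0 => x 0
  | i+1 => minOp (Dseq x i) (x (i+1))

/-- `Tseq x i = x (i+1) ⊔ (x 0 ⊓ ⋯ ⊓ x i)`. -/
noncomputable def Tseq (x : ℕ → ℕ → ℤ) : ℕ → (ℕ → ℤ) :=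
  fun i => maxOp (x (i+1)) (Dseq x i)

/-- The path transformation `G^{(k)}` (coordinates `0,…,k-1`). -/
noncomputable def G : ℕ → (ℕ → ℕ → ℤ) → (ℕ → ℕ → ℤ)
  | 0, x => x
  | 1, x => x
  | (k+2), x => fun i => match i with
      | 0 => Dseq x (k+1)
      | (j+1) => G (k+1) (Tseq x) j

/-- `chainMax y j = y 0 ⊔ y 1 ⊔ ⋯ ⊔ y j` (left to right). -/
noncomputable def chainMax (y : ℕ → ℕ → ℤ) : ℕ → (ℕ → ℤ)
  | 0 => y 0
  | j+1 => maxOp (chainMax y j) (y (j+1))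

theorem minOp_eq (x y : ℕ → ℤ) (n : ℕ) : minOp x y n = x n + y n - maxOp y x n := by
  apply le_antisymm
  · obtain ⟨m, hm, h⟩ := Finset.exists_mem_eq_sup' (s := Finset.range (n+1)) (by simp)
        (fun m => y m + x n - x m)
    have h0 : maxOp y x n = y m + x n - x m := h
    have h1 : minOp x y n ≤ x m + y n - y m :=
      Finset.inf'_le (fun m => x m + y n - y m) hm
    linarith
  · unfold minOp
    refine Finset.le_inf' _ _ ?_
    intro m hm
    have h1 : y m + x n - x m ≤ maxOp y x n :=
      Finset.le_sup' (fun m => y m + x n - x m) hm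
    linarith

/-- all increments are 0 or 1 -/
def Inc (x : ℕ → ℤ) : Prop := ∀ n, x n ≤ x (n+1) ∧ x (n+1) ≤ x n + 1

theorem Inc.maxOp {x y : ℕ → ℤ} (hx : Inc x) (hy : Inc y) : Inc (maxOp x y) := by
  intro n
  have := hx n
  have := hy n
  have := le_maxOp x y n
  rw [maxOp_succ]
  omega

theorem Inc.minOp {x y : ℕ → ℤ} (hx : Inc x) (hy : Inc y) : Inc (minOp x y) := by
  intro n
  have := hx n
  have := hy n
  have := le_maxOp y x n
  rw [minOp_eq, minOp_eq, maxOp_succ]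
  omega

theorem key (a y z : ℕ → ℤ) (hy : Inc y) (hz : Inc z) :
    maxOp (maxOp a (minOp z y)) (maxOp y z) = maxOp (maxOp a y) z := by
  have H : ∀ n, maxOp (maxOp a (minOp z y)) (maxOp y z) n = maxOp (maxOp a y) z n ∧
      maxOp a (minOp z y) n ≤ maxOp a y n ∧
      maxOp (maxOp a y) z n ≤ maxOp a y n + maxOp y z n - y n ∧
      (maxOp a (minOp z y) n = maxOp a y n ∨
        maxOp a y n + maxOp y z n - y n ≤ maxOp (maxOp a y) z n) := by
    intro n
    induction n with
    | zero => simp [maxOp_zero]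
    | succ n ih =>
      have h1 := hy n
      have h2 := hz n
      have h3 := le_maxOp y z n
      have h4 := le_maxOp (maxOp a y) z n
      have h5 := minOp_eq z y n
      have h6 := minOp_eq z y (n+1)
      have e1 := maxOp_succ (maxOp a (minOp z y)) (maxOp y z) n
      have e2 := maxOp_succ (maxOp a y) z n
      have e3 := maxOp_succ a (minOp z y) n
      have e4 := maxOp_succ a y n
      have e5 := maxOp_succ y z n
      generalize maxOp (maxOp a (minOp z y)) (maxOp y z) (n+1) = B' at *
      generalize maxOp (maxOp a (minOp z y)) (maxOp y z) n = B at *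
      generalize maxOp (maxOp a y) z (n+1) = E' at *
      generalize maxOp (maxOp a y) z n = E at *
      generalize maxOp a (minOp z y) (n+1) = A' at *
      generalize maxOp a (minOp z y) n = A at *
      generalize maxOp a y (n+1) = C' at *
      generalize maxOp a y n = C at *
      generalize maxOp y z (n+1) = T' at *
      generalize maxOp y z n = T at *
      generalize minOp z y (n+1) = D' at *
      generalize minOp z y n = D at *
      generalize y (n+1) = y' at *
      generalize y n = y0 at *
      generalize z (n+1) = z' at *
      generalize z n = z0 at *
      generalize a (n+1) = a' at *
      omega
  funext n
  exact (H n).1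

theorem Inc.Dseq {k : ℕ} {x : ℕ → ℕ → ℤ} (hx : ∀ i, i < k → Inc (x i)) :
    ∀ i, i < k → Inc (Dseq x i) := by
  intro i
  induction i with
  | zero => intro h; exact hx 0 h
  | succ i ih => intro h; exact (ih (by omega)).minOp (hx _ h)

theorem chain (K : ℕ) (x : ℕ → ℕ → ℤ) (hx : ∀ i, i < K+2 → Inc (x i)) :
    ∀ j p, j + p = K → chainMax (fun i => Tseq x (K-i)) j =
      maxOp (chainMax (fun i => x (K+1-i)) j) (Dseq x p) := by
  intro j
  induction j with
  | zero => intro p h; obtain rfl : p = K := by omega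
            rfl
  | succ j ih =>
    intro p h
    have e1 : K - (j+1) = p := by omega
    have e2 : K + 1 - (j+1) = p+1 := by omega
    simp only [chainMax]
    rw [ih (p+1) (by omega), e1, e2]
    exact key _ _ _ (hx _ (by omega)) (Inc.Dseq hx p (by omega))

theorem main (K : ℕ) : ∀ (x : ℕ → ℕ → ℤ), (∀ i, i < K+1 → Inc (x i)) →
    G (K+1) x K = chainMax (fun i => x (K-i)) K := by
  induction K with
  | zero => intro x _; rfl
  | succ K ih =>
    intro x hx
    have h1 : G (K+1+1) x (K+1) = G (K+1) (Tseq x) K := rfl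
    rw [h1, ih (Tseq x), chain K x hx K 0 rfl]
    · simp [chainMax, Dseq]
    · intro i hi
      exact (hx _ (by omega)).maxOp (Inc.Dseq hx i (by omega))

/-- the last coordinate of `G^{(k)}(x)` is
`x_k ⊔ x_{k-1} ⊔ ⋯ ⊔ x_1` (evaluated left to right). -/
theorem stmt4 (k : ℕ) (hk : 2 ≤ k) (x : ℕ → ℕ → ℤ) (hx : IsLambdaPath k x) :
    G k x (k-1) = chainMax (fun i => x (k-1-i)) (k-1) := by
  obtain ⟨K, rfl⟩ : ∃ K, k = K+1 := ⟨k-1, by omega⟩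
  refine main K x ?_
  intro i hi n
  rcases hx.2 n with h | ⟨j, hj, h1, h2⟩
  · have := h i hi
    omega
  · by_cases e : i = j
    · subst e; omega
    · have := h2 i hi e
      omega
end

section
/- Let k≥2, n≥1, let a:{1,…,n}→{1,…,k} be a word, and let x∈Π_k be its counting path, x_i(m)=#{1≤j≤m: a_j=i}. Then (x_k⊔x_{k−1}⊔⋯⊔x_1)(n) (evaluated left to right) equals the maximum length of a non-increasing subsequence of a, i.e. the maximum cardinality of a subset {i_1<i_2<⋯<i_j}⊆{1,…,n} with a_{i_1}≥a_{i_2}≥⋯≥a_{i_j}. -/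
/-- The counting path of a word `a`: `cpath a i m = #{j < m : a j = i}`. -/
def cpath (a : ℕ → ℕ) (i : ℕ) (m : ℕ) : ℤ :=
  ((((Finset.range m).filter (fun j => a j = i))).card : ℤ)

theorem cpath_sub (a : ℕ → ℕ) (v m n : ℕ) (h : m ≤ n) :
    cpath a v n - cpath a v m = (((Finset.Ico m n).filter (fun j => a j = v)).card : ℤ) := by
  have hd : Disjoint ((Finset.range m).filter (fun j => a j = v))
      ((Finset.Ico m n).filter (fun j => a j = v)) := by
    rw [Finset.disjoint_left]
    intro x hx hy
    simp at hx hy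
    omega
  have hu : (Finset.range n).filter (fun j => a j = v) =
      ((Finset.range m).filter (fun j => a j = v)) ∪
      ((Finset.Ico m n).filter (fun j => a j = v)) := by
    ext x
    simp only [Finset.mem_filter, Finset.mem_union, Finset.mem_range, Finset.mem_Ico]
    constructor
    · rintro ⟨h1, h2⟩
      by_cases hx : x < m
      · exact Or.inl ⟨hx, h2⟩
      · exact Or.inr ⟨⟨by omega, h1⟩, h2⟩
    · rintro (⟨h1, h2⟩ | ⟨h1, h2⟩)
      · exact ⟨by omega, h2⟩
      · exact ⟨h1.2, h2⟩
  unfold cpath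
  rw [hu, Finset.card_union_of_disjoint hd]
  push_cast
  ring

theorem chain_aux (k n : ℕ) (a : ℕ → ℕ) (ha : ∀ j, j < n → a j < k) (j : ℕ) (hj : j < k) :
    ∀ m ≤ n, IsGreatest
      {c : ℤ | ∃ s : Finset ℕ, s ⊆ Finset.range m ∧ (∀ i ∈ s, k - 1 - j ≤ a i) ∧
        (∀ i ∈ s, ∀ j ∈ s, i ≤ j → a j ≤ a i) ∧ (s.card : ℤ) = c}
      (chainMax (fun i => cpath a (k-1-i)) j m) := by
  induction j with
  | zero =>
    intro m hm
    constructor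
    · refine ⟨(Finset.range m).filter (fun j => a j = k - 1 - 0), Finset.filter_subset _ _,
        ?_, ?_, rfl⟩
      · intro i hi
        exact (Finset.mem_filter.1 hi).2.ge
      · intro i hi j hj _
        rw [(Finset.mem_filter.1 hi).2, (Finset.mem_filter.1 hj).2]
    · rintro c ⟨s, hs, h1, h2, rfl⟩
      simp only [chainMax, cpath]
      norm_cast
      apply Finset.card_le_card
      intro x hx
      have := Finset.mem_range.1 (hs hx)
      have h3 := ha x (by omega)
      have h4 := h1 x hx
      exact Finset.mem_filter.2 ⟨hs hx, by omega⟩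
  | succ j ih =>
    have ih := ih (by omega)
    intro p hp
    obtain ⟨v, hv⟩ : ∃ v, v = k - 1 - (j+1) := ⟨_, rfl⟩
    have hv' : k - 1 - j = v + 1 := by omega
    simp only [chainMax, maxOp]
    rw [← hv]
    rw [hv'] at ih
    constructor
    · obtain ⟨m, hm, he⟩ := Finset.exists_mem_eq_sup' (s := Finset.range (p+1)) (by simp)
        (fun m => chainMax (fun i => cpath a (k-1-i)) j m + cpath a v p - cpath a v m)
      rw [he]
      have hmp : m ≤ p := by simp at hm; omega
      obtain ⟨s, hs, h1, h2, h3⟩ := (ih m (by omega)).1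
      have hc := cpath_sub a v m p hmp
      refine ⟨s ∪ (Finset.Ico m p).filter (fun j => a j = v), ?_, ?_, ?_, ?_⟩
      · intro x hx
        rcases Finset.mem_union.1 hx with hx | hx
        · have := Finset.mem_range.1 (hs hx)
          exact Finset.mem_range.2 (by omega)
        · simp at hx
          exact Finset.mem_range.2 (by omega)
      · intro x hx
        rcases Finset.mem_union.1 hx with hx | hx
        · have := h1 x hx
          omega
        · simp at hx
          omega
      · intro x hx y hy hxy
        rcases Finset.mem_union.1 hx with hx | hx <;> rcases Finset.mem_union.1 hy with hy | hy
        · exact h2 x hx y hy hxy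
        · have := h1 x hx
          simp at hy
          omega
        · have := Finset.mem_range.1 (hs hy)
          simp at hx
          omega
        · simp at hx hy
          omega
      · rw [Finset.card_union_of_disjoint]
        · push_cast
          rw [← hc, h3]
          ring
        · rw [Finset.disjoint_left]
          intro x hx hy
          have := h1 x hx
          simp at hy
          omega
    · rintro c ⟨s, hs, h1, h2, rfl⟩
      obtain ⟨m, hm⟩ : ∃ m, m = (s.filter (fun x => ¬ a x = v)).sup (fun x => x + 1) := ⟨_, rfl⟩
      have hmp : m ≤ p := by
        rw [hm]
        apply Finset.sup_le
        intro x hx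
        exact Finset.mem_range.1 (hs (Finset.mem_filter.1 hx).1)
      have hc := cpath_sub a v m p hmp
      have hA := (ih m (by omega)).2
        ⟨s.filter (fun x => ¬ a x = v), (by
          intro x hx
          have := Finset.le_sup (f := fun x => x + 1) hx
          rw [← hm] at this
          exact Finset.mem_range.2 this), (by
          intro x hx
          have h := Finset.mem_filter.1 hx
          have := h1 x h.1
          omega), (by
          intro x hx y hy
          exact h2 x (Finset.mem_filter.1 hx).1 y (Finset.mem_filter.1 hy).1), rfl⟩
      have hB : (s.filter (fun x => a x = v)).card ≤
          ((Finset.Ico m p).filter (fun j => a j = v)).card := by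
        apply Finset.card_le_card
        intro x hx
        obtain ⟨hx1, hx2⟩ := Finset.mem_filter.1 hx
        refine Finset.mem_filter.2 ⟨Finset.mem_Ico.2 ⟨?_, Finset.mem_range.1 (hs hx1)⟩, hx2⟩
        rw [hm]
        apply Finset.sup_le
        intro y hy
        obtain ⟨hy1, hy2⟩ := Finset.mem_filter.1 hy
        by_contra hlt
        have h5 := h2 x hx1 y hy1 (by omega)
        have h6 := h1 y hy1
        omega
      have hS := Finset.card_filter_add_card_filter_not (s := s) (fun x => a x = v)
      have hle := Finset.le_sup' (s := Finset.range (p+1))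
        (fun m => chainMax (fun i => cpath a (k-1-i)) j m + cpath a v p - cpath a v m)
        (Finset.mem_range.2 (by omega : m < p + 1))
      refine le_trans ?_ hle
      omega

/-- `(x_k ⊔ x_{k-1} ⊔ ⋯ ⊔ x_1)(n)` equals the maximal length of a
non-increasing subsequence of the word `a` (positions `0,…,n-1`). -/
theorem stmt5 (k n : ℕ) (hk : 2 ≤ k) (hn : 1 ≤ n)
    (a : ℕ → ℕ) (ha : ∀ j, j < n → a j < k) :
    IsGreatest
      {c : ℤ | ∃ s : Finset ℕ, s ⊆ Finset.range n ∧
        (∀ i ∈ s, ∀ j ∈ s, i ≤ j → a j ≤ a i) ∧ (s.card : ℤ) = c}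
      (chainMax (fun i => cpath a (k-1-i)) (k-1) n) := by
  have h := chain_aux k n a ha (k-1) (by omega) n le_rfl
  simpa using h
end

section
/- Greene-type identity for G^{(k)}: let k≥2, n≥1, let a:{1,…,n}→{1,…,k} be a word with counting path x∈Π_k (x_i(m)=#{1≤j≤m: a_j=i}). Then for every 1≤i≤k, the sum of the top i coordinates of the transformed path, (G^{(k)}(x))_k(n)+(G^{(k)}(x))_{k−1}(n)+⋯+(G^{(k)}(x))_{k−i+1}(n), equals the maximum of |I_1|+⋯+|I_i| over all families of i pairwise disjoint subsets I_1,…,I_i of {1,…,n} such that for each j, the letters of a read along I_j in increasing index order form a non-increasing sequence. -/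
def Col {α β ι : Type*} [LinearOrder α] [LinearOrder β] (U : Finset α) (a : α → β)
    (f : α → Option ι) : Prop :=
  ∀ x ∈ U, ∀ y ∈ U, x ≤ y → ∀ e, f x = some e → f y = some e → a y ≤ a x

theorem step_fwd {α β ι : Type*} [LinearOrder α] [LinearOrder β] [DecidableEq ι]
    (U : Finset α) (a a' : α → β) (lo hi : β) (hlt : lo < hi) (hcov : ∀ x, x < hi → x ≤ lo)
    (p : α) (hpU : p ∈ U) (hp : a p = hi) (hp' : a' p = lo) (hne : ∀ q, q ≠ p → a' q = a q)
    (hB : ∀ s ∈ U, p < s → a s = hi →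
      (U.filter (fun q => p < q ∧ q ≤ s ∧ a q = hi)).card ≤
      (U.filter (fun q => p < q ∧ q ≤ s ∧ a q = lo)).card) :
    ∀ N : ℕ, ∀ f : α → Option ι, Col U a f →
      (U.filter (fun q => p < q ∧ a q = hi ∧ f q = f p)).card ≤ N →
      ∃ f' : α → Option ι, Col U a' f' ∧
        (U.filter (fun x => (f x).isSome)).card ≤ (U.filter (fun x => (f' x).isSome)).card := by
  intro N
  induction N with
  | zero =>
    intro f hf h0
    refine ⟨f, ?_, le_rfl⟩
    have h0' : ∀ q ∈ U, p < q → a q = hi → f q ≠ f p := by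
      intro q hq h1 h2 h3
      have : q ∈ (U.filter (fun q => p < q ∧ a q = hi ∧ f q = f p)) := by simp [*]
      rw [Finset.card_eq_zero.mp (Nat.le_zero.mp h0)] at this
      simp at this
    intro x hx y hy hxy e hxe hye
    have := hf x hx y hy hxy e hxe hye
    rcases eq_or_ne x p with rfl | hxp
    · rcases eq_or_ne y x with rfl | hyp
      · simp
      · rw [hp', hne y hyp]
        apply hcov
        have h1 := h0' y hy (lt_of_le_of_ne hxy (Ne.symm hyp))
        rw [hp] at this
        exact lt_of_le_of_ne this (fun h => h1 h (by rw [hxe, hye]))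
    · rcases eq_or_ne y p with rfl | hyp
      · rw [hp', hne x hxp]; rw [hp] at this; exact hlt.le.trans this
      · rw [hne x hxp, hne y hyp]; exact this
  | succ N ih =>
    intro f hf hN
    by_cases hle : (U.filter (fun q => p < q ∧ a q = hi ∧ f q = f p)).card ≤ N
    · exact ih f hf hle
    rcases hc : f p with _ | c
    · refine ⟨f, ?_, le_rfl⟩
      intro x hx y hy hxy e hxe hye
      have := hf x hx y hy hxy e hxe hye
      rw [hne x (by rintro rfl; simp_all), hne y (by rintro rfl; simp_all)]
      exact this
    rw [hc] at hN hle
    by_cases hA : ∃ d, d ≠ c ∧ ∀ q ∈ U, f q = some d → (q < p → lo ≤ a q) ∧ (p < q → a q ≤ lo)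
    · obtain ⟨d, hdc, hd⟩ := hA
      refine ⟨Function.update f p (some d), ?_, ?_⟩
      · intro x hx y hy hxy e hxe hye
        rcases eq_or_ne x p with rfl | hxp
        · rcases eq_or_ne y x with rfl | hyp
          · simp
          · simp [hyp] at hxe hye
            subst hxe
            rw [hp', hne y hyp]
            exact (hd y hy hye).2 (lt_of_le_of_ne hxy (Ne.symm hyp))
        · rcases eq_or_ne y p with rfl | hyp
          · simp [hxp] at hxe hye
            subst hye
            rw [hp', hne x hxp]
            exact (hd x hx hxe).1 (lt_of_le_of_ne hxy hxp)
          · simp [hxp, hyp] at hxe hye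
            rw [hne x hxp, hne y hyp]; exact hf x hx y hy hxy e hxe hye
      · apply Finset.card_le_card
        intro x
        simp only [Finset.mem_filter]
        rintro ⟨h1, h2⟩
        refine ⟨h1, ?_⟩
        rcases eq_or_ne x p with rfl | hxp
        · simp
        · simpa [hxp] using h2
    · push Not at hA
      set S := U.filter (fun q => p < q ∧ a q = hi ∧ f q = some c) with hS
      have hSne : S.Nonempty := by
        rw [← Finset.card_pos]; omega
      set s := S.max' hSne with hs
      have hsS : s ∈ S := Finset.max'_mem _ _
      have hsmax : ∀ x ∈ S, x ≤ s := fun x hx => Finset.le_max' _ _ hx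
      clear_value s
      obtain ⟨hsU, hps, has, hfs⟩ : s ∈ U ∧ p < s ∧ a s = hi ∧ f s = some c := by
        simpa [hS] using hsS
      by_cases hq : ∃ q ∈ U, p < q ∧ q < s ∧ a q = lo ∧ ∃ d, d ≠ c ∧ f q = some d
      · classical
        set Q := U.filter (fun q => p < q ∧ q < s ∧ a q = lo ∧ ∃ d, d ≠ c ∧ f q = some d) with hQ
        have hQne : Q.Nonempty := by
          obtain ⟨q, h1, h2⟩ := hq
          exact ⟨q, by rw [hQ, Finset.mem_filter]; exact ⟨h1, h2⟩⟩
        set q := Q.min' hQne with hqdef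
        have hqQ : q ∈ Q := Finset.min'_mem _ _
        have hqmin : ∀ x ∈ Q, q ≤ x := fun x hx => Finset.min'_le _ _ hx
        clear_value q
        obtain ⟨hqU, hpq, hqs, haq, d, hdc, hfq⟩ := Finset.mem_filter.mp hqQ
        have hdq : ∀ x ∈ U, f x = some d → x < q → hi ≤ a x := by
          intro x hx hfx hxq
          by_contra hcon
          have h1 := hcov _ (not_le.mp hcon)
          have h2 := hf x hx q hqU hxq.le d hfx hfq
          rw [haq] at h2
          have h3 : a x = lo := le_antisymm h1 h2
          rcases lt_trichotomy x p with h | h | h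
          · obtain ⟨z, hz, hfz, hz'⟩ := hA d hdc
            have h5 : z < p → lo ≤ a z := by
              intro h6
              have := hf z hz q hqU (h6.trans hpq).le d hfz hfq
              rwa [haq] at this
            have h7 := hz' h5
            have := hf x hx z hz (h.trans h7.1).le d hfx hfz
            rw [h3] at this
            exact absurd this (not_le.mpr h7.2)
          · subst h
            rw [hc] at hfx
            exact hdc (Option.some.inj hfx).symm
          · exact absurd (hqmin x (Finset.mem_filter.mpr ⟨hx, h, hxq.trans hqs, h3, d, hdc, hfx⟩))
              (not_le.mpr hxq)
        have hcq : ∀ x ∈ U, f x = some c → q ≤ x → a x ≤ hi := by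
          intro x hx hfx hqx
          have := hf p hpU x hx (hpq.trans_le hqx).le c hc hfx
          rwa [hp] at this
        have hcq' : ∀ x ∈ U, f x = some c → x < q → hi ≤ a x := by
          intro x hx hfx hqx
          have := hf x hx s hsU (hqx.trans hqs).le c hfx hfs
          rwa [has] at this
        have hdq' : ∀ x ∈ U, f x = some d → q ≤ x → a x ≤ lo := by
          intro x hx hfx hqx
          have := hf q hqU x hx hqx d hfq hfx
          rwa [haq] at this
        set g : α → Option ι := fun z => if q ≤ z then
          (if f z = some c then some d else if f z = some d then some c else f z) else f z with hg
        have hgc : ∀ z, z < q → g z = f z := by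
          intro z hz; simp [hg, not_le.mpr hz]
        have hg1 : ∀ z, q ≤ z → g z = some c → f z = some d := by
          intro z hz; simp only [hg, hz, if_true]; grind
        have hg2 : ∀ z, q ≤ z → g z = some d → f z = some c := by
          intro z hz; simp only [hg, hz, if_true]; grind
        have hg3 : ∀ z e, e ≠ c → e ≠ d → g z = some e → f z = some e := by
          intro z e; simp only [hg]; grind
        have hg4 : ∀ z, (g z).isSome = (f z).isSome := by
          intro z; simp only [hg]; grind
        clear_value g
        have hcol : Col U a g := by
          intro x hx y hy hxy e hxe hye
          by_cases hec : e = c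
          · subst hec
            rcases lt_or_ge x q with h1 | h1
            · rw [hgc x h1] at hxe
              rcases lt_or_ge y q with h2 | h2
              · rw [hgc y h2] at hye
                exact hf x hx y hy hxy _ hxe hye
              · exact (hdq' y hy (hg1 y h2 hye) h2).trans (hlt.le.trans (hcq' x hx hxe h1))
            · exact hf x hx y hy hxy _ (hg1 x h1 hxe) (hg1 y (h1.trans hxy) hye)
          · by_cases hed : e = d
            · subst hed
              rcases lt_or_ge x q with h1 | h1
              · rw [hgc x h1] at hxe
                rcases lt_or_ge y q with h2 | h2
                · rw [hgc y h2] at hye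
                  exact hf x hx y hy hxy _ hxe hye
                · exact (hcq y hy (hg2 y h2 hye) h2).trans ((hdq x hx hxe h1))
              · exact hf x hx y hy hxy _ (hg2 x h1 hxe) (hg2 y (h1.trans hxy) hye)
            · exact hf x hx y hy hxy _ (hg3 x e hec hed hxe) (hg3 y e hec hed hye)
        obtain ⟨f', hf', hcard⟩ := ih g hcol (by
          rw [hgc p hpq, hc]
          have : (U.filter (fun z => p < z ∧ a z = hi ∧ g z = some c)) ⊂ S := by
            rw [Finset.ssubset_iff_of_subset]
            · refine ⟨s, hsS, ?_⟩
              intro h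
              obtain ⟨_, _, _, h4⟩ := Finset.mem_filter.mp h
              have := hg1 s hqs.le h4
              rw [hfs] at this
              exact hdc (Option.some.inj this).symm
            · intro z hz
              obtain ⟨h1, h2, h3, h4⟩ := Finset.mem_filter.mp hz
              refine Finset.mem_filter.mpr ⟨h1, h2, h3, ?_⟩
              rcases lt_or_ge z q with h5 | h5
              · rwa [hgc z h5] at h4
              · have := hdq' z h1 (hg1 z h5 h4) h5
                rw [h3] at this
                exact absurd this (not_le.mpr hlt)
          have := Finset.card_lt_card this
          omega)
        refine ⟨f', hf', le_trans (le_of_eq ?_) hcard⟩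
        simp only [hg4]
      · push Not at hq
        have hfree : ∀ x ∈ U, p < x → x ≤ s → a x = lo → f x = none := by
          intro x hx h1 h2 h3
          rcases hfx : f x with _ | e
          · rfl
          · exfalso
            have hxs : x < s := lt_of_le_of_ne h2 (by rintro rfl; exact hlt.ne (h3.symm.trans has))
            have hec : e = c := by
              by_contra hec
              exact hq x hx h1 hxs h3 e hec hfx
            subst hec
            have := hf x hx s hsU h2 e hfx hfs
            rw [h3, has] at this
            exact absurd this (not_le.mpr hlt)
        set L := U.filter (fun q => p < q ∧ q ≤ s ∧ a q = lo) with hL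
        refine ⟨fun x => if x ∈ S then none else if x ∈ L then some c else f x, ?_, ?_⟩
        · have hpS : p ∉ S := fun h => lt_irrefl _ (Finset.mem_filter.mp h).2.1
          have hpL : p ∉ L := fun h => lt_irrefl _ (Finset.mem_filter.mp h).2.1
          have key : ∀ z ∈ U, (if z ∈ S then none else if z ∈ L then some c else f z) = some c →
              (z < p ∧ hi ≤ a' z ∧ f z = some c) ∨ (p ≤ z ∧ z ≤ s ∧ a' z = lo) ∨
              (s < z ∧ a' z ≤ lo ∧ f z = some c) := by
            intro z hz hfz
            by_cases h1 : z ∈ S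
            · simp [h1] at hfz
            by_cases h2 : z ∈ L
            · obtain ⟨_, h3, h4, h5⟩ := Finset.mem_filter.mp h2
              exact Or.inr (Or.inl ⟨h3.le, h4, by rw [hne z h3.ne', h5]⟩)
            simp only [h1, h2, if_false] at hfz
            rcases lt_trichotomy z p with h | h | h
            · left
              have := hf z hz p hpU h.le c hfz hc
              rw [hp] at this
              exact ⟨h, by rwa [hne z h.ne], hfz⟩
            · right; left
              subst h
              exact ⟨le_rfl, hps.le, hp'⟩
            · right; right
              have h3 := hf p hpU z hz h.le c hc hfz
              rw [hp] at h3
              have h4 : a z ≠ hi := fun h5 => h1 (Finset.mem_filter.mpr ⟨hz, h, h5, hfz⟩)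
              have h5 := hcov _ (lt_of_le_of_ne h3 h4)
              refine ⟨?_, by rwa [hne z h.ne'], hfz⟩
              by_contra h6
              have := hf z hz s hsU (not_lt.mp h6) c hfz hfs
              rw [has] at this
              exact absurd (this.trans h5) (not_le.mpr hlt)
          intro x hx y hy hxy e hxe hye
          by_cases hec : e = c
          · subst hec
            rcases key x hx hxe with ⟨h1, h2, h3⟩ | ⟨h1, h2, h3⟩ | ⟨h1, h2, h3⟩ <;>
            rcases key y hy hye with ⟨h4, h5, h6⟩ | ⟨h4, h5, h6⟩ | ⟨h4, h5, h6⟩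
            · rw [hne x h1.ne, hne y h4.ne]; exact hf x hx y hy hxy _ h3 h6
            · rw [h6]; exact hlt.le.trans h2
            · exact h5.trans (hlt.le.trans h2)
            · exact absurd (hxy.trans_lt h4) (not_lt.mpr h1)
            · rw [h3, h6]
            · rw [h3]; exact h5
            · exact absurd ((hps.trans h1).trans_le hxy) (not_lt.mpr h4.le)
            · exact absurd (h1.trans_le hxy) (not_lt.mpr h5)
            · rw [hne x (hps.trans h1).ne', hne y (hps.trans h4).ne']
              exact hf x hx y hy hxy _ h3 h6
          · have hx1 : f x = some e := by
              beta_reduce at hxe; grind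
            have hy1 : f y = some e := by
              beta_reduce at hye; grind
            have hxp : x ≠ p := by
              rintro rfl; rw [hc] at hx1; exact hec (Option.some.inj hx1).symm
            have hyp : y ≠ p := by
              rintro rfl; rw [hc] at hy1; exact hec (Option.some.inj hy1).symm
            rw [hne x hxp, hne y hyp]
            exact hf x hx y hy hxy e hx1 hy1
        · have h1 : S.card ≤ L.card := by
            refine le_trans (Finset.card_le_card ?_) (hB s hsU hps has)
            intro x hx
            have := hsmax x hx
            simp [hS] at hx ⊢
            tauto
          set F := U.filter (fun x => (f x).isSome) with hF
          have hLF : Disjoint L F := by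
            rw [Finset.disjoint_left]
            intro x hx hx'
            simp [hL] at hx
            simp [hF] at hx'
            simp [hfree x hx.1 hx.2.1 hx.2.2.1 hx.2.2.2] at hx'
          have hSF : S ⊆ F := by
            intro x hx
            simp [hS] at hx
            simp [hF, hx]
          have h2 : (F \ S) ∪ L ⊆ (U.filter (fun x => Option.isSome (if x ∈ S then none else if x ∈ L then some c else f x))) := by
            intro x hx
            have hSL : ∀ x ∈ S, x ∉ L := fun x h1 h2 => (Finset.disjoint_left.mp hLF h2 (hSF h1))
            have : x ∈ L → x ∈ U := fun h => (Finset.mem_filter.mp h).1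
            have : x ∈ F → x ∈ U ∧ (f x).isSome := fun h => (Finset.mem_filter.mp h)
            grind
          refine le_trans ?_ (Finset.card_le_card h2)
          rw [Finset.card_union_of_disjoint, Finset.card_sdiff_of_subset hSF]
          · have := Finset.card_le_card hSF
            omega
          · exact Finset.disjoint_of_subset_left Finset.sdiff_subset hLF.symm

theorem step_bwd {α β ι : Type*} [LinearOrder α] [LinearOrder β] [DecidableEq ι]
    (U : Finset α) (a a' : α → β) (lo hi : β) (hlt : lo < hi) (hcov : ∀ x, lo < x → hi ≤ x)
    (p : α) (hpU : p ∈ U) (hp : a p = lo) (hp' : a' p = hi) (hne : ∀ q, q ≠ p → a' q = a q)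
    (hB : ∀ s ∈ U, s < p → a s = lo →
      (U.filter (fun q => q < p ∧ s ≤ q ∧ a q = lo)).card ≤
      (U.filter (fun q => q < p ∧ s ≤ q ∧ a q = hi)).card)
    (f : α → Option ι) (hf : Col U a f) :
      ∃ f' : α → Option ι, Col U a' f' ∧
        (U.filter (fun x => (f x).isSome)).card ≤ (U.filter (fun x => (f' x).isSome)).card := by
  obtain ⟨f', h1, h2⟩ := step_fwd (α := αᵒᵈ) (β := βᵒᵈ) (ι := ι) U a a' hi lo hlt hcov p hpU hp hp' hne
    hB _ f (fun x hx y hy hxy e h1 h2 => hf y hy x hx hxy e h2 h1) le_rfl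
  exact ⟨f', (fun x hx y hy hxy e h3 h4 => h1 y hy x hx hxy e h4 h3), h2⟩

def Val (n : ℕ) (b : ℕ → ℕ) (i : ℕ) (c : ℕ) : Prop :=
  ∃ f : ℕ → Option (Fin i), Col (Finset.range n) b f ∧
    c ≤ ((Finset.range n).filter (fun x => (f x).isSome)).card

theorem cpath_succ (a : ℕ → ℕ) (i m : ℕ) :
    cpath a i (m+1) = cpath a i m + if a m = i then 1 else 0 := by
  unfold cpath
  rw [Finset.range_add_one, Finset.filter_insert]
  split_ifs with h
  · rw [Finset.card_insert_of_notMem (by simp)]; push_cast; ring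
  · simp

theorem cpath_zero (a : ℕ → ℕ) (i : ℕ) : cpath a i 0 = 0 := by simp [cpath]

theorem cpath_Ico (a : ℕ → ℕ) (i u v : ℕ) (h : u ≤ v) :
    (((Finset.Ico u v).filter (fun q => a q = i)).card : ℤ) = cpath a i v - cpath a i u := by
  induction v, h using Nat.le_induction with
  | base => simp
  | succ v hv ih =>
    rw [cpath_succ, show Finset.Ico u (v+1) = insert v (Finset.Ico u v) by ext q; simp; omega,
      Finset.filter_insert]
    split_ifs with h
    · rw [Finset.card_insert_of_notMem (by simp)]; push_cast; linarith
    · linarith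

theorem step_equiv (n : ℕ) (b : ℕ → ℕ) (j p : ℕ) (hpn : p < n) (hbp : b p = j + 1)
    (hB : ∀ m ≤ n, cpath b (j+1) m - cpath b j m ≤ cpath b (j+1) (p+1) - cpath b j (p+1))
    (hA : ∀ m ≤ p, cpath b (j+1) m - cpath b j m < cpath b (j+1) (p+1) - cpath b j (p+1))
    (i c : ℕ) : Val n b i c ↔ Val n (Function.update b p j) i c := by
  constructor
  · rintro ⟨f, hf, hc⟩
    obtain ⟨f', h1, h2⟩ := step_fwd (Finset.range n) b (Function.update b p j) j (j+1) (by omega)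
      (by intros; omega) p (by simpa) hbp (by simp) (by intro q hq; simp [hq]) (by
        intro s hs hps has
        have hs' : s < n := by simpa using hs
        have e : ∀ l, (Finset.range n).filter (fun q => p < q ∧ q ≤ s ∧ b q = l) =
            (Finset.Ico (p+1) (s+1)).filter (fun q => b q = l) := by
          intro l; ext q; simp; omega
        rw [e, e]
        apply Int.ofNat_le.mp
        rw [cpath_Ico _ _ _ _ (by omega), cpath_Ico _ _ _ _ (by omega)]
        have := hB (s+1) (by omega)
        linarith) _ f hf le_rfl
    exact ⟨f', h1, hc.trans h2⟩
  · rintro ⟨f, hf, hc⟩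
    obtain ⟨f', h1, h2⟩ := step_bwd (Finset.range n) (Function.update b p j) b j (j+1) (by omega)
      (by intros; omega) p (by simpa) (by simp) hbp (by intro q hq; simp [hq]) (by
        intro s hs hps has
        have hs' : s < n := by simpa using hs
        have e : ∀ l, (Finset.range n).filter
            (fun q => q < p ∧ s ≤ q ∧ Function.update b p j q = l) =
            (Finset.Ico s p).filter (fun q => b q = l) := by
          intro l; ext q
          by_cases hqp : q = p
          · simp [hqp]
          · simp [hqp]; omega
        rw [e, e]
        apply Int.ofNat_le.mp
        rw [cpath_Ico _ _ _ _ (by omega), cpath_Ico _ _ _ _ (by omega)]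
        have h3 := hA s (by omega)
        rw [cpath_succ, cpath_succ, hbp] at h3
        simp at h3
        linarith) f hf
    exact ⟨f', h1, hc.trans h2⟩

theorem maxOp_spec (x y : ℕ → ℤ) (n : ℕ) (v : ℤ) :
    maxOp x y n = v ↔ (∀ m ≤ n, x m + y n - y m ≤ v) ∧ ∃ m ≤ n, x m + y n - y m = v := by
  have h1 : ∀ m ≤ n, x m + y n - y m ≤ maxOp x y n := by
    intro m hm
    exact Finset.le_sup' (fun m => x m + y n - y m) (by simp; omega)
  obtain ⟨m, hm, hm'⟩ := Finset.exists_mem_eq_sup' (s := Finset.range (n+1)) (by simp)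
    (fun m => x m + y n - y m)
  have hm'' : maxOp x y n = x m + y n - y m := hm'
  simp at hm
  constructor
  · rintro rfl
    exact ⟨h1, m, by omega, hm''.symm⟩
  · rintro ⟨h2, m', h3, h4⟩
    apply le_antisymm
    · rw [hm'']; exact h2 m (by omega)
    · rw [← h4]; exact h1 m' h3

theorem minOp_spec (x y : ℕ → ℤ) (n : ℕ) (v : ℤ) :
    minOp x y n = v ↔ (∀ m ≤ n, v ≤ x m + y n - y m) ∧ ∃ m ≤ n, x m + y n - y m = v := by
  have h1 : ∀ m ≤ n, minOp x y n ≤ x m + y n - y m := by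
    intro m hm
    exact Finset.inf'_le (fun m => x m + y n - y m) (by simp; omega)
  obtain ⟨m, hm, hm'⟩ := Finset.exists_mem_eq_inf' (s := Finset.range (n+1)) (by simp)
    (fun m => x m + y n - y m)
  have hm'' : minOp x y n = x m + y n - y m := hm'
  simp at hm
  constructor
  · rintro rfl
    exact ⟨h1, m, by omega, hm''.symm⟩
  · rintro ⟨h2, m', h3, h4⟩
    apply le_antisymm
    · rw [← h4]; exact h1 m' h3
    · rw [hm'']; exact h2 m (by omega)

theorem cpath_update (b : ℕ → ℕ) (p j l m : ℕ) (hbp : b p = j + 1) :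
    cpath (Function.update b p j) l m =
      cpath b l m + (if l = j ∧ p < m then 1 else 0) - (if l = j + 1 ∧ p < m then 1 else 0) := by
  induction m with
  | zero => simp [cpath_zero]
  | succ m ih =>
    rw [cpath_succ, cpath_succ, ih]
    by_cases h : m = p
    · subst h
      simp [hbp]
      split_ifs <;> omega
    · simp only [Function.update_of_ne h]
      have : p < m + 1 ↔ p < m := by omega
      simp only [this]
      ring

theorem pitman_aux (n j : ℕ) (M : ℕ) : ∀ b : ℕ → ℕ,
    (∀ m ≤ n, cpath b (j+1) m - cpath b j m ≤ M) →
    ∃ b' : ℕ → ℕ, (∀ i c, Val n b i c ↔ Val n b' i c) ∧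
      (∀ K, j + 2 ≤ K → (∀ m < n, b m < K) → ∀ m < n, b' m < K) ∧
      (∀ m ≤ n, cpath b' j m = maxOp (cpath b (j+1)) (cpath b j) m) ∧
      (∀ m ≤ n, cpath b' (j+1) m = minOp (cpath b j) (cpath b (j+1)) m) ∧
      (∀ l, l ≠ j → l ≠ j + 1 → ∀ m ≤ n, cpath b' l m = cpath b l m) := by
  induction M with
  | zero =>
    intro b hb
    have key : ∀ m ≤ n, maxOp (cpath b (j+1)) (cpath b j) m = cpath b j m := by
      intro m hm
      rw [maxOp_spec]
      refine ⟨fun m' hm' => ?_, 0, by omega, by simp [cpath_zero]⟩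
      have := hb m' (by omega)
      push_cast at this
      linarith
    refine ⟨b, fun _ _ => Iff.rfl, fun K _ h => h, fun m hm => (key m hm).symm, fun m hm => ?_,
      fun _ _ _ _ _ => rfl⟩
    rw [minOp_eq, key m hm]; ring
  | succ M ih =>
    intro b hb
    by_cases hex : ∃ m, m ≤ n ∧ cpath b (j+1) m - cpath b j m = M + 1
    swap
    · push Not at hex
      apply ih
      intro m hm
      have h1 := hb m hm
      have h2 := hex m hm
      push_cast at h1
      omega
    obtain ⟨q, ⟨hqn, hq⟩, hmin⟩ : ∃ q, (q ≤ n ∧ cpath b (j+1) q - cpath b j q = M + 1) ∧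
        ∀ m < q, ¬ (m ≤ n ∧ cpath b (j+1) m - cpath b j m = M + 1) :=
      ⟨Nat.find hex, Nat.find_spec hex, fun m hm => Nat.find_min hex hm⟩
    obtain _ | p := q
    · simp [cpath_zero] at hq; omega
    have hlt : ∀ m ≤ p, cpath b (j+1) m - cpath b j m ≤ M := by
      intro m hm
      have h1 := hb m (by omega)
      have h2 := hmin m (by omega)
      push_cast at h1
      have h3 : m ≤ n := by omega
      simp only [h3, true_and] at h2
      omega
    have hbp : b p = j + 1 := by
      have h1 := hlt p le_rfl
      rw [cpath_succ, cpath_succ] at hq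
      by_contra h
      rw [if_neg h] at hq
      split_ifs at hq <;> omega
    have hpM : cpath b (j+1) p - cpath b j p = M := by
      rw [cpath_succ, cpath_succ, hbp] at hq
      simp at hq
      omega
    push_cast at hb
    have heq := step_equiv n b j p (by omega) hbp (fun m hm => by rw [hq]; exact hb m hm)
      (fun m hm => by rw [hq]; have := hlt m hm; omega)
    set b1 := Function.update b p j with hb1
    have e1 : ∀ m, cpath b1 j m = cpath b j m + if p < m then 1 else 0 := by
      intro m; rw [hb1, cpath_update _ _ _ _ _ hbp]; simp
    have e2 : ∀ m, cpath b1 (j+1) m = cpath b (j+1) m - if p < m then 1 else 0 := by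
      intro m; rw [hb1, cpath_update _ _ _ _ _ hbp]; simp
    have e3 : ∀ l, l ≠ j → l ≠ j+1 → ∀ m, cpath b1 l m = cpath b l m := by
      intro l h1 h2 m; rw [hb1, cpath_update _ _ _ _ _ hbp]; simp [h1, h2]
    obtain ⟨b', h1, h2, h3, h4, h5⟩ := ih b1 (by
      intro m hm
      rw [e1, e2]
      have h1 := hb m hm
      split_ifs with h
      · omega
      · have := hlt m (by omega); omega)
    have key : ∀ m ≤ n, maxOp (cpath b1 (j+1)) (cpath b1 j) m =
        maxOp (cpath b (j+1)) (cpath b j) m := by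
      intro m hm
      obtain ⟨g1, m', g2, g3⟩ := (maxOp_spec (cpath b (j+1)) (cpath b j) m _).mp rfl
      rw [maxOp_spec]
      by_cases hpm : p < m
      · have hv : maxOp (cpath b (j+1)) (cpath b j) m = cpath b j m + M + 1 := by
          apply le_antisymm
          · rw [← g3]; have := hb m' (by omega); linarith
          · have := g1 (p+1) (by omega); linarith
        rw [hv]
        refine ⟨fun m'' hm'' => ?_, p, hpm.le, ?_⟩
        · rw [e1, e1, e2, if_pos hpm]
          split_ifs with h
          · have := hb m'' (by omega); linarith
          · have := hlt m'' (by omega); linarith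
        · rw [e1, e1, e2, if_pos hpm]; simp; linarith
      · refine ⟨fun m'' hm'' => ?_, m', g2, ?_⟩
        · rw [e1, e1, e2, if_neg hpm, if_neg (by omega)]
          have := g1 m'' hm''; linarith
        · rw [e1, e1, e2, if_neg hpm, if_neg (by omega)]
          linarith
    refine ⟨b', fun i c => (heq i c).trans (h1 i c), ?_, ?_, ?_, ?_⟩
    · intro K hK hbK
      apply h2 K hK
      intro m hm
      by_cases h : m = p
      · subst h; simp [hb1]; omega
      · rw [hb1, Function.update_of_ne h]; exact hbK m hm
    · intro m hm; rw [h3 m hm, key m hm]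
    · intro m hm
      rw [h4 m hm, minOp_eq, minOp_eq, key m hm, e1, e2]; ring
    · intro l g1 g2 m hm
      rw [h5 l g1 g2 m hm, e3 l g1 g2]

theorem pitman (n j : ℕ) (b : ℕ → ℕ) :
    ∃ b' : ℕ → ℕ, (∀ i c, Val n b i c ↔ Val n b' i c) ∧
      (∀ K, j + 2 ≤ K → (∀ m < n, b m < K) → ∀ m < n, b' m < K) ∧
      (∀ m ≤ n, cpath b' j m = maxOp (cpath b (j+1)) (cpath b j) m) ∧
      (∀ m ≤ n, cpath b' (j+1) m = minOp (cpath b j) (cpath b (j+1)) m) ∧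
      (∀ l, l ≠ j → l ≠ j + 1 → ∀ m ≤ n, cpath b' l m = cpath b l m) := by
  apply pitman_aux n j n b
  intro m hm
  have h1 : cpath b (j+1) m ≤ m := by
    unfold cpath
    exact_mod_cast (Finset.card_filter_le _ _).trans (by simp)
  have h2 : 0 ≤ cpath b j m := by unfold cpath; positivity
  omega

theorem maxOp_congr (n : ℕ) (x y x' y' : ℕ → ℤ) (hx : ∀ m ≤ n, x m = x' m)
    (hy : ∀ m ≤ n, y m = y' m) : ∀ m ≤ n, maxOp x y m = maxOp x' y' m := by
  intro m hm
  obtain ⟨h1, m', h2, h3⟩ := (maxOp_spec x' y' m _).mp rfl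
  rw [maxOp_spec]
  refine ⟨fun t ht => ?_, m', h2, ?_⟩
  · rw [hx t (by omega), hy t (by omega), hy m hm]; exact h1 t ht
  · rw [hx m' (by omega), hy m' (by omega), hy m hm]; exact h3

theorem minOp_congr (n : ℕ) (x y x' y' : ℕ → ℤ) (hx : ∀ m ≤ n, x m = x' m)
    (hy : ∀ m ≤ n, y m = y' m) : ∀ m ≤ n, minOp x y m = minOp x' y' m := by
  intro m hm
  rw [minOp_eq, minOp_eq, hx m hm, hy m hm, maxOp_congr n _ _ _ _ hy hx m hm]

theorem Dseq_congr (n k : ℕ) (x y : ℕ → ℕ → ℤ) (h : ∀ l < k, ∀ m ≤ n, x l m = y l m) :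
    ∀ r < k, ∀ m ≤ n, Dseq x r m = Dseq y r m := by
  intro r
  induction r with
  | zero => exact h 0
  | succ r ih =>
    intro hr
    exact minOp_congr n _ _ _ _ (ih (by omega)) (h _ hr)

theorem G_congr (n k : ℕ) : ∀ (x y : ℕ → ℕ → ℤ), (∀ l < k, ∀ m ≤ n, x l m = y l m) →
    ∀ r < k, ∀ m ≤ n, G k x r m = G k y r m := by
  induction k with
  | zero => intros; omega
  | succ k ih =>
    intro x y h r hr m hm
    obtain _ | k := k
    · exact h r hr m hm
    obtain _ | r := r
    · exact Dseq_congr n (k+2) x y h (k+1) (by omega) m hm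
    · refine ih (Tseq x) (Tseq y) ?_ r (by omega) m hm
      intro l hl
      exact maxOp_congr n _ _ _ _ (h _ (by omega)) (Dseq_congr n (k+2) x y h l (by omega))

theorem sweep (n r : ℕ) (b : ℕ → ℕ) :
    ∃ b' : ℕ → ℕ, (∀ i c, Val n b i c ↔ Val n b' i c) ∧
      (∀ K, r + 1 ≤ K → (∀ m < n, b m < K) → ∀ m < n, b' m < K) ∧
      (∀ l < r, ∀ m ≤ n, cpath b' l m = Tseq (cpath b) l m) ∧
      (∀ m ≤ n, cpath b' r m = Dseq (cpath b) r m) ∧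
      (∀ l, r < l → ∀ m ≤ n, cpath b' l m = cpath b l m) := by
  induction r with
  | zero => exact ⟨b, fun _ _ => Iff.rfl, fun _ _ h => h, by intros; omega, fun _ _ => rfl,
      fun _ _ _ _ => rfl⟩
  | succ r ih =>
    obtain ⟨b1, h1, h2, h3, h4, h5⟩ := ih
    obtain ⟨b', g1, g2, g3, g4, g5⟩ := pitman n r b1
    refine ⟨b', fun i c => (h1 i c).trans (g1 i c), fun K hK h => g2 K hK (h2 K (by omega) h),
      ?_, ?_, ?_⟩
    · intro l hl m hm
      rcases Nat.lt_succ_iff_lt_or_eq.mp hl with h | rfl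
      · rw [g5 l (by omega) (by omega) m hm, h3 l h m hm]
      · rw [g3 m hm]
        exact maxOp_congr n _ _ _ _ (h5 _ (by omega)) h4 m hm
    · intro m hm
      rw [g4 m hm]
      exact minOp_congr n _ _ _ _ h4 (h5 _ (by omega)) m hm
    · intro l hl m hm
      rw [g5 l (by omega) (by omega) m hm, h5 l (by omega) m hm]

theorem full (n k : ℕ) : ∀ (b : ℕ → ℕ),
    ∃ b' : ℕ → ℕ, (∀ i c, Val n b i c ↔ Val n b' i c) ∧
      (∀ K, k + 1 ≤ K → (∀ m < n, b m < K) → ∀ m < n, b' m < K) ∧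
      (∀ l ≤ k, ∀ m ≤ n, cpath b' l m = G (k+1) (cpath b) (k - l) m) ∧
      (∀ l, k < l → ∀ m ≤ n, cpath b' l m = cpath b l m) := by
  induction k with
  | zero =>
    intro b
    refine ⟨b, fun _ _ => Iff.rfl, fun _ _ h => h, ?_, fun _ _ _ _ => rfl⟩
    intro l hl m hm
    obtain rfl : l = 0 := by omega
    rfl
  | succ k ih =>
    intro b
    obtain ⟨b1, h1, h2, h3, h4, h5⟩ := sweep n (k+1) b
    obtain ⟨b', g1, g2, g3, g4⟩ := ih b1
    refine ⟨b', fun i c => (h1 i c).trans (g1 i c),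
      fun K hK h => g2 K (by omega) (h2 K (by omega) h), ?_, ?_⟩
    · intro l hl m hm
      rcases Nat.lt_or_ge k l with h | h
      · obtain rfl : l = k + 1 := by omega
        rw [g4 _ h m hm, h4 m hm, Nat.sub_self]
        rfl
      · rw [g3 l h m hm, show k + 1 - l = (k - l) + 1 by omega]
        exact G_congr n (k+1) (cpath b1) (Tseq (cpath b)) (fun l hl => h3 l hl) (k-l) (by omega) m hm
    · intro l hl m hm
      rw [g4 l (by omega) m hm, h5 l (by omega) m hm]

theorem D_le (x : ℕ → ℕ → ℤ) (hx : ∀ l, x l 0 = 0) (r : ℕ) :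
    ∀ m, Dseq x (r+1) m ≤ Dseq (Tseq x) r m := by
  induction r with
  | zero =>
    intro m
    have h1 := ((minOp_spec (x 0) (x 1) m _).mp rfl).1 m le_rfl
    have h2 := ((maxOp_spec (x 1) (x 0) m _).mp rfl).1 0 (by omega)
    rw [hx, hx] at h2
    change minOp (x 0) (x 1) m ≤ maxOp (x 1) (x 0) m
    linarith
  | succ r ih =>
    intro m
    change minOp (Dseq x (r+1)) (x (r+2)) m ≤ minOp (Dseq (Tseq x) r) (maxOp (x (r+2)) (Dseq x (r+1))) m
    obtain ⟨h1, t, ht, h2⟩ := (minOp_spec (Dseq (Tseq x) r) (maxOp (x (r+2)) (Dseq x (r+1))) m _).mp rfl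
    rw [← h2]
    have h3 := ih t
    generalize Dseq x (r+1) = D at *
    generalize x (r+2) = y at *
    have e1 := minOp_eq D y m
    have e2 := minOp_eq D y t
    have i1 := ((minOp_spec D y m _).mp rfl).1 m le_rfl
    obtain ⟨_, t', ht', h5⟩ := (minOp_spec D y t _).mp rfl
    have i2 := ((minOp_spec D y m _).mp rfl).1 t' (by omega)
    linarith

theorem G_mono (k : ℕ) : ∀ (x : ℕ → ℕ → ℤ), (∀ l, x l 0 = 0) →
    ∀ r, r + 1 < k → ∀ m, G k x r m ≤ G k x (r+1) m := by
  induction k with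
  | zero => intros; omega
  | succ k ih =>
    intro x hx r hr m
    obtain _ | k := k
    · omega
    obtain _ | r := r
    · have h := D_le x hx k m
      have e : G (k+1) (Tseq x) 0 = Dseq (Tseq x) k := by
        cases k <;> rfl
      change Dseq x (k+1) m ≤ G (k+1) (Tseq x) 0 m
      rw [e]; exact h
    · refine ih (Tseq x) ?_ r (by omega) m
      intro l
      change maxOp _ _ 0 = 0
      rw [maxOp_spec]
      refine ⟨fun m hm => ?_, 0, le_rfl, ?_⟩
      · obtain rfl : m = 0 := by omega
        simp [hx]
      · simp [hx]

theorem cpath_mono (b : ℕ → ℕ) (l u v : ℕ) (h : u ≤ v) : cpath b l u ≤ cpath b l v := by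
  have := cpath_Ico b l u v h
  have h2 : (0 : ℤ) ≤ (((Finset.Ico u v).filter (fun q => b q = l)).card : ℤ) := by positivity
  omega

theorem upper (n k i : ℕ) (b : ℕ → ℕ) (hbk : ∀ m < n, b m < k) (hi1 : 1 ≤ i) (hik : i ≤ k)
    (hdom : ∀ l l', l ≤ l' → l' < k → ∀ m ≤ n, cpath b l' m ≤ cpath b l m)
    (f : ℕ → Option (Fin i)) (hf : Col (Finset.range n) b f) :
    (((Finset.range n).filter (fun x => (f x).isSome)).card : ℤ)
      ≤ ∑ l ∈ Finset.range i, cpath b l n := by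
  set C := (Finset.range n).filter (fun x => (f x).isSome) with hC
  -- index of a position
  set ix : ℕ → ℕ := fun p => ((Finset.range p).filter (fun j => b j = b p)).card with hix
  set lam : ℕ → ℕ := fun l => ((Finset.range n).filter (fun j => b j = l)).card with hlam
  have hixc : ∀ p, (ix p : ℤ) = cpath b (b p) p := fun p => rfl
  have hlamc : ∀ l, (lam l : ℤ) = cpath b l n := fun l => rfl
  have hixlam : ∀ p < n, ix p < lam (b p) := by
    intro p hp
    have h1 := cpath_succ b (b p) p
    have h2 := cpath_mono b (b p) (p+1) n hp
    have h3 := hixc p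
    have h4 := hlamc (b p)
    simp at h1
    omega
  have hixlt : ∀ p < n, ix p < n := by
    intro p hp
    have : ix p ≤ p := (Finset.card_filter_le _ _).trans (by simp)
    omega
  have hlamn : ∀ l, lam l ≤ n := fun l => (Finset.card_filter_le _ _).trans (by simp)
  have hlammono : ∀ l l', l ≤ l' → l' < k → lam l' ≤ lam l := by
    intro l l' h1 h2
    have := hdom l l' h1 h2 n le_rfl
    rw [← hlamc, ← hlamc] at this
    exact_mod_cast this
  -- strictly increasing along noninreasing pairs
  have hinc : ∀ p q, p < q → q < n → b q ≤ b p → ix p < ix q := by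
    intro p q hpq hq hb
    have h1 := cpath_succ b (b p) p
    have h2 := hdom (b q) (b p) hb (hbk p (by omega)) (p+1) (by omega)
    have h3 := cpath_mono b (b q) (p+1) q hpq
    have h4 := hixc p
    have h5 := hixc q
    simp at h1
    omega
  -- positions with same letter have distinct index
  have hinj : ∀ p q, p < n → q < n → b p = b q → ix p = ix q → p = q := by
    intro p q hp hq h1 h2
    rcases lt_trichotomy p q with h | h | h
    · have := hinc p q h hq h1.ge; omega
    · exact h
    · have := hinc q p h hp h1.le; omega
  have hcol : ∀ t, (C.filter (fun p => ix p = t)).card ≤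
      ((Finset.range i).filter (fun l => t < lam l)).card := by
    intro t
    by_cases ht : t < lam (i-1)
    · have e : (Finset.range i).filter (fun l => t < lam l) = Finset.range i := by
        apply Finset.filter_true_of_mem
        intro l hl
        simp at hl
        exact lt_of_lt_of_le ht (hlammono l (i-1) (by omega) (by omega))
      rw [e, Finset.card_range]
      have := Finset.card_le_card_of_injOn (s := C.filter (fun p => ix p = t))
        (t := (Finset.univ : Finset (Fin i)).image some) f
        (by
          intro p hp
          simp [hC] at hp
          obtain ⟨e, he⟩ := Option.isSome_iff_exists.mp hp.1.2
          simp [he])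
        (by
          intro p hp q hq hpq
          simp [hC] at hp hq
          obtain ⟨e, he⟩ := Option.isSome_iff_exists.mp hp.1.2
          have he' : f q = some e := by rw [← hpq, he]
          rcases lt_trichotomy p q with h | h | h
          · have := hinc p q h hq.1.1 (hf p (by simp; omega) q (by simp; omega) h.le e he he'); omega
          · exact h
          · have := hinc q p h hp.1.1 (hf q (by simp; omega) p (by simp; omega) h.le e he' he); omega)
      refine this.trans (Finset.card_image_le.trans ?_)
      simp
    · apply Finset.card_le_card_of_injOn b
      · intro p hp
        simp [hC] at hp
        have h1 := hixlam p hp.1.1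
        have h2 : b p < i := by
          by_contra hcon
          have := hlammono (i-1) (b p) (by omega) (hbk p hp.1.1)
          omega
        simp
        omega
      · intro p hp q hq hpq
        simp [hC] at hp hq
        exact hinj p q hp.1.1 hq.1.1 hpq (by omega)
  have h1 : C.card = ∑ t ∈ Finset.range n, (C.filter (fun p => ix p = t)).card := by
    apply Finset.card_eq_sum_card_fiberwise
    intro p hp
    simp [hC] at hp
    simp
    exact hixlt p hp.1
  have h2 : ∑ t ∈ Finset.range n, ((Finset.range i).filter (fun l => t < lam l)).card =
      ∑ l ∈ Finset.range i, lam l := by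
    simp only [Finset.card_filter]
    rw [Finset.sum_comm]
    apply Finset.sum_congr rfl
    intro l hl
    rw [← Finset.card_filter]
    have : (Finset.range n).filter (fun t => t < lam l) = Finset.range (lam l) := by
      ext t; have := hlamn l; simp; omega
    rw [this, Finset.card_range]
  have h3 : C.card ≤ ∑ l ∈ Finset.range i, lam l := by
    rw [h1, ← h2]
    exact Finset.sum_le_sum (fun t _ => hcol t)
  calc (C.card : ℤ) ≤ ((∑ l ∈ Finset.range i, lam l : ℕ) : ℤ) := by exact_mod_cast h3
    _ = _ := by push_cast; rfl

theorem lower (n i : ℕ) (b : ℕ → ℕ) :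
    ∃ f : ℕ → Option (Fin i), Col (Finset.range n) b f ∧
    (((Finset.range n).filter (fun x => (f x).isSome)).card : ℤ)
      = ∑ l ∈ Finset.range i, cpath b l n := by
  refine ⟨fun x => if h : b x < i then some ⟨b x, h⟩ else none, ?_, ?_⟩
  · intro x hx y hy hxy e h1 h2
    beta_reduce at h1 h2
    split_ifs at h1 h2
    simp at h1 h2
    rw [← h1] at h2
    simp at h2
    exact h2.le
  · have e : (Finset.range n).filter (fun x =>
        (if h : b x < i then some (⟨b x, h⟩ : Fin i) else none).isSome) =
        (Finset.range n).filter (fun x => b x < i) := by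
      apply Finset.filter_congr
      intro x _
      split_ifs with h <;> simp [h]
    rw [e, Finset.card_eq_sum_card_fiberwise (f := b) (t := Finset.range i)]
    · push_cast
      apply Finset.sum_congr rfl
      intro l hl
      unfold cpath
      congr 2
      ext x
      simp at hl ⊢
      omega
    · intro x hx
      simp at hx ⊢
      exact hx.2

theorem col_to_fam (n i : ℕ) (a : ℕ → ℕ) (f : ℕ → Option (Fin i)) (hf : Col (Finset.range n) a f) :
    ∃ I : Fin i → Finset ℕ,
        (∀ j j', j ≠ j' → Disjoint (I j) (I j')) ∧
        (∀ j, I j ⊆ Finset.range n) ∧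
        (∀ j, ∀ m ∈ I j, ∀ m' ∈ I j, m ≤ m' → a m' ≤ a m) ∧
        (∑ j, ((I j).card : ℤ)) =
          (((Finset.range n).filter (fun x => (f x).isSome)).card : ℤ) := by
  refine ⟨fun j => (Finset.range n).filter (fun x => f x = some j), ?_, ?_, ?_, ?_⟩
  · intro j j' h
    rw [Finset.disjoint_left]
    intro x h1 h2
    simp at h1 h2
    rw [h1.2] at h2
    exact h (Option.some.inj h2.2)
  · intro j; exact Finset.filter_subset _ _
  · intro j m hm m' hm' h
    rw [Finset.mem_filter] at hm hm'
    exact hf m hm.1 m' hm'.1 h j hm.2 hm'.2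
  · rw [← Nat.cast_sum]
    congr 1
    rw [← Finset.card_biUnion]
    · congr 1
      ext x
      simp [Option.isSome_iff_exists]
    · intro j _ j' _ h
      rw [Function.onFun, Finset.disjoint_left]
      intro x h1 h2
      simp at h1 h2
      rw [h1.2] at h2
      exact h (Option.some.inj h2.2)

theorem fam_to_col (n i : ℕ) (a : ℕ → ℕ) (I : Fin i → Finset ℕ)
    (h1 : ∀ j j', j ≠ j' → Disjoint (I j) (I j'))
    (h2 : ∀ j, I j ⊆ Finset.range n)
    (h3 : ∀ j, ∀ m ∈ I j, ∀ m' ∈ I j, m ≤ m' → a m' ≤ a m) :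
    ∃ f : ℕ → Option (Fin i), Col (Finset.range n) a f ∧
      (∑ j, ((I j).card : ℤ)) =
          (((Finset.range n).filter (fun x => (f x).isSome)).card : ℤ) := by
  classical
  set f : ℕ → Option (Fin i) := fun x => if h : ∃ j, x ∈ I j then some h.choose else none with hfdef
  have hf1 : ∀ x j, f x = some j → x ∈ I j := by
    intro x j h
    simp only [hfdef] at h
    split_ifs at h with h'
    have := h'.choose_spec
    rwa [Option.some.inj h] at this
  have hf2 : ∀ x, (f x).isSome ↔ ∃ j, x ∈ I j := by
    intro x
    simp only [hfdef]
    split_ifs with h' <;> simp [h']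
  refine ⟨f, ?_, ?_⟩
  · intro x _ y _ hxy e hx hy
    exact h3 e x (hf1 x e hx) y (hf1 y e hy) hxy
  · rw [← Nat.cast_sum]
    congr 1
    rw [← Finset.card_biUnion (fun j _ j' _ h => h1 j j' h)]
    congr 1
    ext x
    simp only [Finset.mem_biUnion, Finset.mem_univ, true_and, Finset.mem_filter, hf2]
    constructor
    · rintro ⟨j, hj⟩; exact ⟨h2 j hj, j, hj⟩
    · exact fun h => h.2

theorem stmt6 (k n : ℕ) (hk : 2 ≤ k) (hn : 1 ≤ n)
    (a : ℕ → ℕ) (ha : ∀ j, j < n → a j < k)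
    (i : ℕ) (hi1 : 1 ≤ i) (hik : i ≤ k) :
    IsGreatest
      {c : ℤ | ∃ I : Fin i → Finset ℕ,
        (∀ j j', j ≠ j' → Disjoint (I j) (I j')) ∧
        (∀ j, I j ⊆ Finset.range n) ∧
        (∀ j, ∀ m ∈ I j, ∀ m' ∈ I j, m ≤ m' → a m' ≤ a m) ∧
        (∑ j, ((I j).card : ℤ)) = c}
      (∑ j ∈ Finset.Ico (k-i) k, G k (cpath a) j n) := by
  obtain ⟨k, rfl⟩ : ∃ k', k = k' + 1 := ⟨k - 1, by omega⟩
  obtain ⟨b, h1, h2, h3, -⟩ := full n k a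
  have hbk := h2 (k+1) le_rfl ha
  have hdom1 : ∀ l, l + 1 < k + 1 → ∀ m ≤ n, cpath b (l+1) m ≤ cpath b l m := by
    intro l hl m hm
    rw [h3 l (by omega) m hm, h3 (l+1) (by omega) m hm, show k - l = (k - (l+1)) + 1 by omega]
    exact G_mono (k+1) _ (fun l => cpath_zero a l) _ (by omega) m
  have hdom : ∀ l l', l ≤ l' → l' < k + 1 → ∀ m ≤ n, cpath b l' m ≤ cpath b l m := by
    intro l l' h
    induction l', h using Nat.le_induction with
    | base => intros; exact le_rfl
    | succ l' h ih =>
      intro hl m hm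
      exact (hdom1 l' hl m hm).trans (ih (by omega) m hm)
  have hsum : ∑ j ∈ Finset.Ico (k+1-i) (k+1), G (k+1) (cpath a) j n =
      ∑ l ∈ Finset.range i, cpath b l n := by
    refine (Finset.sum_bij (fun l _ => k - l) ?_ ?_ ?_ ?_).symm
    · intro l hl; simp at hl ⊢; omega
    · intro l hl l' hl' h; simp at hl hl' h; omega
    · intro j hj
      simp at hj
      exact ⟨k - j, by simp; omega, by omega⟩
    · intro l hl
      simp at hl
      exact h3 l (by omega) n le_rfl
  rw [hsum]
  have hup : ∀ I : Fin i → Finset ℕ,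
        (∀ j j', j ≠ j' → Disjoint (I j) (I j')) →
        (∀ j, I j ⊆ Finset.range n) →
        (∀ j, ∀ m ∈ I j, ∀ m' ∈ I j, m ≤ m' → a m' ≤ a m) →
        (∑ j, ((I j).card : ℤ)) ≤ ∑ l ∈ Finset.range i, cpath b l n := by
    intro I g1 g2 g3
    obtain ⟨f, hf, hc⟩ := fam_to_col n i a I g1 g2 g3
    rw [hc]
    obtain ⟨f', hf', hc'⟩ := (h1 i _).mp ⟨f, hf, le_rfl⟩
    have := upper n (k+1) i b hbk hi1 hik hdom f' hf'
    exact le_trans (by exact_mod_cast hc') this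
  constructor
  · obtain ⟨f, hf, hc⟩ := lower n i b
    obtain ⟨f', hf', hc'⟩ := (h1 i _).mpr ⟨f, hf, le_rfl⟩
    obtain ⟨I, g1, g2, g3, g4⟩ := col_to_fam n i a f' hf'
    refine ⟨I, g1, g2, g3, le_antisymm (hup I g1 g2 g3) ?_⟩
    rw [g4, ← hc]
    exact_mod_cast hc'
  · rintro c ⟨I, g1, g2, g3, rfl⟩
    exact hup I g1 g2 g3
end

section
/- Let p=(p_1,…,p_k) with all p_i>0, and let r=(r_1,…,r_k) be a probability vector (r_i≥0, ∑_i r_i=1). Define h_r:ℤ_+^k→ℝ by h_r(x)=p^{−x}·s_{x^*}(r) if x∈W, and h_r(x)=0 otherwise. Then h_r is harmonic on W for the transition kernel P(x,y)=p^{y−x}·1{y−x∈{e_1,…,e_k}}: for every x∈W∩ℤ_+^k, ∑_{i=1}^k p_i·h_r(x+e_i) = h_r(x). Moreover h_r is strictly positive on W∩ℤ_+^k when all r_i>0. -/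
/-- The cells of the Young diagram of shape `lam` (row lengths), within the
first `k` rows. -/
def cells (k : ℕ) (lam : ℕ → ℕ) : Finset (ℕ × ℕ) :=
  (Finset.range k ×ˢ Finset.range ((Finset.range k).sup lam)).filter
    (fun rc => rc.2 < lam rc.1)

/-- `T` is a semistandard Young tableau of shape `lam` with entries in
`{0,…,k-1}` (0-based version of entries `{1,…,k}`): rows weakly increase,
columns strictly increase, and `T` vanishes outside the diagram. -/
def IsSSYT (k : ℕ) (lam : ℕ → ℕ) (T : ℕ → ℕ → ℕ) : Prop :=
  (∀ r c, c < lam r → T r c < k) ∧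
  (∀ r c, ¬ c < lam r → T r c = 0) ∧
  (∀ r c c', c ≤ c' → c' < lam r → T r c ≤ T r c') ∧
  (∀ r r' c, r < r' → c < lam r' → T r c < T r' c)

/-- Number of entries of `T` (of shape `lam`, within `k` rows) equal to `i`. -/
def entryCount (k : ℕ) (lam : ℕ → ℕ) (T : ℕ → ℕ → ℕ) (i : ℕ) : ℕ :=
  ((cells k lam).filter (fun rc => T rc.1 rc.2 = i)).card

/-- The Schur polynomial `s_lam(p) = ∑_T p^{weight(T)}`, summing over all
semistandard tableaux of shape `lam` with entries in `{0,…,k-1}`. -/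
noncomputable def schur (k : ℕ) (lam : ℕ → ℕ) (p : ℕ → ℝ) : ℝ :=
  ∑' T : {T : ℕ → ℕ → ℕ // IsSSYT k lam T},
    ∏ i ∈ Finset.range k, p i ^ entryCount k lam T.1 i

/-- The reversed vector `x^*` of `x ∈ ℤ_+^k`, as a shape (`lam j = x_{k-1-j}`
for `j < k`, `0` otherwise). -/
def revPart (k : ℕ) (x : ℕ → ℕ) : ℕ → ℕ :=
  fun j => if j < k then x (k-1-j) else 0

-- The function `h_r(x) = p^{-x} s_{x^*}(r) 1_{x ∈ W}`.
open Classical in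
noncomputable def hrFun (k : ℕ) (p r : ℕ → ℝ) (x : ℕ → ℕ) : ℝ :=
  if ∀ i, i + 1 < k → x i ≤ x (i+1) then
    (∏ i ∈ Finset.range k, (p i)⁻¹ ^ x i) * schur k (revPart k x) r
  else 0


def Supp (k : ℕ) (lam : ℕ → ℕ) : Prop := ∀ i, k ≤ i → lam i = 0

def Dom (lam : ℕ → ℕ) : Prop := ∀ i, lam (i+1) ≤ lam i

def Intl (k : ℕ) (lam nu : ℕ → ℕ) : Prop :=
  (∀ i, i < k → lam (i+1) ≤ nu i ∧ nu i ≤ lam i) ∧ Supp k nu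

def addE (lam : ℕ → ℕ) (i : ℕ) : ℕ → ℕ := fun j => if j = i then lam j + 1 else lam j

def subE (lam : ℕ → ℕ) (i : ℕ) : ℕ → ℕ := fun j => if j = i then lam j - 1 else lam j

def sz (k : ℕ) (lam : ℕ → ℕ) : ℕ := ∑ i ∈ Finset.range k, lam i

theorem Dom.anti {lam : ℕ → ℕ} (h : Dom lam) : Antitone lam := antitone_nat_of_succ_le h

theorem Intl.dom {k lam nu} (h : Intl k lam nu) (hl : Supp (k+1) lam) : Dom lam := by
  intro i
  by_cases hi : i < k
  · have := h.1 i hi; omega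
  · rw [hl (i+1) (by omega)]; omega

theorem Intl.dom' {k lam nu} (h : Intl k lam nu) : Dom nu := by
  intro i
  by_cases hi : i + 1 < k
  · have := h.1 i (by omega); have := h.1 (i+1) hi; omega
  · rw [h.2 (i+1) (by omega)]; omega

theorem sz_le {k lam nu} (h : Intl k lam nu) : sz k nu ≤ sz (k+1) lam := by
  unfold sz
  rw [Finset.sum_range_succ]
  have : ∑ i ∈ Finset.range k, nu i ≤ ∑ i ∈ Finset.range k, lam i :=
    Finset.sum_le_sum (fun i hi => (h.1 i (Finset.mem_range.1 hi)).2)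
  omega

theorem sz_addE {k lam i} (h : i < k) : sz k (addE lam i) = sz k lam + 1 := by
  have : ∀ j, addE lam i j = lam j + if j = i then 1 else 0 := by
    intro j; unfold addE; split_ifs <;> rfl
  simp [sz, this, Finset.sum_add_distrib, h]

theorem addE_subE {lam i} (h : 1 ≤ lam i) : addE (subE lam i) i = lam := by
  funext j
  by_cases h1 : j = i
  · subst h1; simp only [addE, subE, if_true]; omega
  · simp [addE, subE, h1]

theorem subE_addE {lam i} : subE (addE lam i) i = lam := by
  funext j
  by_cases h1 : j = i
  · subst h1; simp only [addE, subE, if_true]; omega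
  · simp [addE, subE, h1]

theorem mem_cells {k lam a} : a ∈ cells k lam ↔ a.1 < k ∧ a.2 < lam a.1 := by
  simp only [cells, Finset.mem_filter, Finset.mem_product, Finset.mem_range]
  constructor
  · rintro ⟨⟨h1, h2⟩, h3⟩; exact ⟨h1, h3⟩
  · rintro ⟨h1, h3⟩
    exact ⟨⟨h1, lt_of_lt_of_le h3 (Finset.le_sup (f := lam) (Finset.mem_range.2 h1))⟩, h3⟩

theorem card_cells (k lam) : (cells k lam).card = sz k lam := by
  have : cells k lam = (Finset.range k).biUnion
      (fun i => (Finset.range (lam i)).image (fun c => (i, c))) := by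
    ext ⟨a, b⟩
    simp [mem_cells]
  rw [this, Finset.card_biUnion]
  · unfold sz
    refine Finset.sum_congr rfl fun i _ => ?_
    rw [Finset.card_image_of_injective _ (fun a b h => by simpa using h)]
    simp
  · intro i _ j _ hij
    simp only [Function.onFun]
    rw [Finset.disjoint_left]
    rintro ⟨a, b⟩ h1 h2
    simp at h1 h2
    omega

/-- cut a row-increasing filling at value k -/
def cutS (k : ℕ) (lam : ℕ → ℕ) (T : ℕ → ℕ → ℕ) : ℕ → ℕ :=
  fun i => ((Finset.range (lam i)).filter (fun c => T i c < k)).card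

theorem lt_cutS {k lam T} (hT : IsSSYT (k+1) lam T) (i c : ℕ) :
    c < cutS k lam T i ↔ c < lam i ∧ T i c < k := by
  have hdown : ∀ c c', c ≤ c' → (c' < lam i ∧ T i c' < k) → (c < lam i ∧ T i c < k) := by
    intro c c' h ⟨h1, h2⟩
    exact ⟨by omega, lt_of_le_of_lt (hT.2.2.1 i c c' h h1) h2⟩
  constructor
  · intro h
    by_contra hc
    have : (Finset.range (lam i)).filter (fun c => T i c < k) ⊆ Finset.range c := by
      intro d hd
      simp only [Finset.mem_filter, Finset.mem_range] at hd ⊢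
      by_contra hcd
      exact hc (hdown c d (by omega) hd)
    have := Finset.card_le_card this
    simp only [Finset.card_range] at this
    unfold cutS at h
    omega
  · intro h
    have : Finset.range (c+1) ⊆ (Finset.range (lam i)).filter (fun c => T i c < k) := by
      intro d hd
      simp only [Finset.mem_filter, Finset.mem_range] at hd ⊢
      exact hdown d c (by omega) h
    have := Finset.card_le_card this
    simp only [Finset.card_range] at this
    unfold cutS
    omega

theorem ssyt_ge {k lam T} (hd : Dom lam) (hT : IsSSYT k lam T) (i c : ℕ) (h : c < lam i) :
    i ≤ T i c := by
  induction i with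
  | zero => omega
  | succ i ih =>
    have := ih (lt_of_lt_of_le h (hd i))
    have := hT.2.2.2 i (i+1) c (by omega) h
    omega

theorem cutS_inter {k lam T} (hd : Dom lam) (hT : IsSSYT (k+1) lam T) :
    Intl k lam (cutS k lam T) := by
  refine ⟨fun i hi => ⟨?_, ?_⟩, fun i hi => ?_⟩
  · by_contra h
    have h' : ¬ cutS k lam T i < cutS k lam T i := lt_irrefl _
    rw [lt_cutS hT] at h'
    have h1 : cutS k lam T i < lam (i+1) := by omega
    have h2 := hT.2.2.2 i (i+1) _ (by omega) h1
    have h3 := hT.1 _ _ h1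
    exact h' ⟨lt_of_lt_of_le h1 (hd i), by omega⟩
  · by_contra h
    have := (lt_cutS hT i (lam i)).1 (by omega)
    omega
  · by_contra h
    have := (lt_cutS hT i 0).1 (by omega)
    have := ssyt_ge hd hT i 0 this.1
    omega

def cutT (k : ℕ) (lam : ℕ → ℕ) (T : ℕ → ℕ → ℕ) : ℕ → ℕ → ℕ :=
  fun i c => if c < cutS k lam T i then T i c else 0

def glueT (k : ℕ) (lam nu : ℕ → ℕ) (T : ℕ → ℕ → ℕ) : ℕ → ℕ → ℕ :=
  fun i c => if c < nu i then T i c else if c < lam i then k else 0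

theorem cutT_ssyt {k lam T} (hd : Dom lam) (hT : IsSSYT (k+1) lam T) :
    IsSSYT k (cutS k lam T) (cutT k lam T) := by
  refine ⟨fun i c h => ?_, fun i c h => ?_, fun i c c' h h' => ?_, fun i i' c h h' => ?_⟩
  · simp only [cutT, if_pos h]; exact ((lt_cutS hT _ _).1 h).2
  · simp only [cutT, if_neg h]
  · simp only [cutT, if_pos h', if_pos (lt_of_le_of_lt h h')]
    exact hT.2.2.1 _ _ _ h ((lt_cutS hT _ _).1 h').1
  · have := (cutS_inter hd hT).dom'.anti h.le
    simp only [cutT, if_pos h', if_pos (lt_of_lt_of_le h' this)]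
    exact hT.2.2.2 _ _ _ h ((lt_cutS hT _ _).1 h').1

theorem Intl.le {k lam nu} (h : Intl k lam nu) (i : ℕ) : nu i ≤ lam i := by
  by_cases hi : i < k
  · exact (h.1 i hi).2
  · rw [h.2 i (by omega)]; omega

theorem Intl.ge {k lam nu} (hl : Supp (k+1) lam) (h : Intl k lam nu) (i : ℕ) :
    lam (i+1) ≤ nu i := by
  by_cases hi : i < k
  · exact (h.1 i hi).1
  · rw [hl (i+1) (by omega)]; omega

theorem glueT_ssyt {k lam nu T} (hl : Supp (k+1) lam) (hI : Intl k lam nu)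
    (hT : IsSSYT k nu T) : IsSSYT (k+1) lam (glueT k lam nu T) := by
  have hd := hI.dom hl
  refine ⟨fun i c h => ?_, fun i c h => ?_, fun i c c' h h' => ?_, fun i i' c h h' => ?_⟩
  · unfold glueT
    split_ifs with h1
    · have := hT.1 _ _ h1; omega
    · omega
  · have := hI.le i
    unfold glueT
    rw [if_neg (by omega), if_neg h]
  · unfold glueT
    have := hI.le i
    by_cases h1 : c' < nu i
    · rw [if_pos h1, if_pos (by omega)]; exact hT.2.2.1 _ _ _ h h1
    · rw [if_neg h1, if_pos h']
      split_ifs with h2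
      · exact (hT.1 _ _ h2).le
      · exact le_rfl
      · omega
  · unfold glueT
    have h1 : c < nu i := lt_of_lt_of_le h' ((hd.anti (show i + 1 ≤ i' by omega)).trans (hI.ge hl i))
    rw [if_pos h1]
    split_ifs with h2
    · exact hT.2.2.2 _ _ _ h h2
    · exact hT.1 _ _ h1

theorem cutS_glue {k lam nu T} (hl : Supp (k+1) lam) (hI : Intl k lam nu)
    (hT : IsSSYT k nu T) : cutS k lam (glueT k lam nu T) = nu := by
  funext i
  have key : ∀ c, c < cutS k lam (glueT k lam nu T) i ↔ c < nu i := by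
    intro c
    rw [lt_cutS (glueT_ssyt hl hI hT)]
    unfold glueT
    constructor
    · rintro ⟨h1, h2⟩
      by_contra h
      rw [if_neg h, if_pos h1] at h2
      omega
    · intro h
      rw [if_pos h]
      exact ⟨lt_of_lt_of_le h (hI.le i), hT.1 _ _ h⟩
  have h1 := key (nu i)
  have h2 := key (cutS k lam (glueT k lam nu T) i)
  omega

theorem cutT_glue {k lam nu T} (hl : Supp (k+1) lam) (hI : Intl k lam nu)
    (hT : IsSSYT k nu T) : cutT k lam (glueT k lam nu T) = T := by
  funext i c
  unfold cutT
  rw [cutS_glue hl hI hT]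
  split_ifs with h
  · simp [glueT, h]
  · exact (hT.2.1 _ _ h).symm

theorem glue_cut {k lam T} (hT : IsSSYT (k+1) lam T) :
    glueT k lam (cutS k lam T) (cutT k lam T) = T := by
  funext i c
  unfold glueT cutT
  by_cases h : c < cutS k lam T i
  · simp [h]
  · rw [if_neg h]
    split_ifs with h1
    · rw [lt_cutS hT] at h
      have := hT.1 _ _ h1
      have : ¬ T i c < k := fun h2 => h ⟨h1, h2⟩
      omega
    · exact (hT.2.1 _ _ h1).symm

def ssytEquiv (k : ℕ) (lam : ℕ → ℕ) (hl : Supp (k+1) lam) (hd : Dom lam) :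
    {T : ℕ → ℕ → ℕ // IsSSYT (k+1) lam T} ≃
      (Σ nu : {nu : ℕ → ℕ // Intl k lam nu}, {T : ℕ → ℕ → ℕ // IsSSYT k nu.1 T}) where
  toFun T := ⟨⟨cutS k lam T.1, cutS_inter hd T.2⟩, ⟨cutT k lam T.1, cutT_ssyt hd T.2⟩⟩
  invFun a := ⟨glueT k lam a.1.1 a.2.1, glueT_ssyt hl a.1.2 a.2.2⟩
  left_inv T := Subtype.ext (glue_cut T.2)
  right_inv := by
    rintro ⟨⟨nu, hI⟩, ⟨T, hT⟩⟩
    have h1 := cutS_glue hl hI hT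
    have h2 := cutT_glue hl hI hT
    refine Sigma.ext (Subtype.ext h1) ?_
    refine (Subtype.heq_iff_coe_eq ?_).2 h2
    intro T'
    show IsSSYT k (cutS k lam (glueT k lam nu T)) T' ↔ IsSSYT k nu T'
    rw [h1]

theorem count_glue_lt {k lam nu T} (hI : Intl k lam nu) (i : ℕ)
    (hi : i < k) : entryCount (k+1) lam (glueT k lam nu T) i = entryCount k nu T i := by
  unfold entryCount
  congr 1
  ext ⟨a, c⟩
  simp only [Finset.mem_filter, mem_cells]
  unfold glueT
  constructor
  · rintro ⟨⟨h1, h2⟩, h3⟩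
    by_cases h : c < nu a
    · rw [if_pos h] at h3
      refine ⟨⟨?_, h⟩, h3⟩
      by_contra ha
      have := hI.2 a (by omega)
      omega
    · rw [if_neg h, if_pos h2] at h3; omega
  · rintro ⟨⟨h1, h2⟩, h3⟩
    have := hI.le a
    rw [if_pos h2]
    exact ⟨⟨by omega, by omega⟩, h3⟩

theorem count_glue_eq {k lam nu T} (hI : Intl k lam nu) (hT : IsSSYT k nu T) :
    entryCount (k+1) lam (glueT k lam nu T) k = sz (k+1) lam - sz k nu := by
  unfold entryCount
  rw [← card_cells, ← card_cells]
  have hsub : cells k nu ⊆ cells (k+1) lam := by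
    rintro ⟨a, c⟩ h
    rw [mem_cells] at h ⊢
    have := hI.le a
    exact ⟨by omega, by simp only at *; omega⟩
  rw [← Finset.card_sdiff_of_subset hsub]
  congr 1
  ext ⟨a, c⟩
  simp only [Finset.mem_filter, Finset.mem_sdiff, mem_cells]
  unfold glueT
  refine and_congr_right ?_
  rintro ⟨h1, h2⟩
  by_cases h : c < nu a
  · rw [if_pos h]
    have := hT.1 _ _ h
    have : a < k := by
      by_contra ha
      have := hI.2 a (by omega)
      omega
    constructor
    · intro; omega
    · intro h; omega
  · rw [if_neg h, if_pos h2]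
    simp only [true_iff]
    omega

/-- bounded functions -/
theorem finite_box (k N : ℕ) : {nu : ℕ → ℕ | (∀ i, nu i ≤ N) ∧ Supp k nu}.Finite := by
  refine Set.Finite.of_injOn (f := fun nu => (fun i : Fin k => nu i))
    (t := (Fintype.piFinset (fun _ : Fin k => Finset.range (N+1)) : Set (Fin k → ℕ)))
    ?_ ?_ (Finset.finite_toSet _)
  · intro nu h
    simp only [Finset.mem_coe, Fintype.mem_piFinset, Finset.mem_range]
    intro i
    have := h.1 i
    omega
  · intro a ha b hb hab
    funext i
    by_cases hi : i < k
    · exact congrFun hab ⟨i, hi⟩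
    · rw [ha.2 i (by omega), hb.2 i (by omega)]

noncomputable def box (k N : ℕ) : Finset (ℕ → ℕ) := (finite_box k N).toFinset

theorem mem_box {k N nu} : nu ∈ box k N ↔ (∀ i, nu i ≤ N) ∧ Supp k nu := by
  simp [box]

theorem Intl.mem_box {k N lam nu} (hd : Dom lam) (h0 : lam 0 ≤ N) (h : Intl k lam nu) :
    nu ∈ box k N := by
  rw [_root_.mem_box]
  exact ⟨fun i => (h.le i).trans ((hd.anti (Nat.zero_le i)).trans h0), h.2⟩

instance finite_inter (k lam) : Finite {nu : ℕ → ℕ // Intl k lam nu} := by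
  refine Set.Finite.subset (finite_box k (sz k lam)) ?_
  intro nu h
  refine ⟨fun i => ?_, h.2⟩
  by_cases hi : i < k
  · exact (h.1 i hi).2.trans (Finset.single_le_sum (f := lam) (fun _ _ => Nat.zero_le _)
      (Finset.mem_range.2 hi))
  · rw [h.2 i (by omega)]; omega

theorem ssyt_zero {lam T} (hl : Supp 0 lam) (hT : IsSSYT 0 lam T) : T = fun _ _ => 0 := by
  funext i c
  exact hT.2.1 i c (by rw [hl i (by omega)]; omega)

theorem zero_ssyt {lam} (hl : Supp 0 lam) : IsSSYT 0 lam (fun _ _ => 0) := by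
  have h : ∀ i, lam i = 0 := fun i => hl i (by omega)
  refine ⟨?_, ?_, ?_, ?_⟩ <;> intros <;> simp_all

theorem finite_ssyt (k : ℕ) : ∀ lam, Supp k lam → Dom lam →
    Finite {T : ℕ → ℕ → ℕ // IsSSYT k lam T} := by
  induction k with
  | zero =>
    intro lam hl _
    have : Subsingleton {T : ℕ → ℕ → ℕ // IsSSYT 0 lam T} :=
      ⟨fun a b => Subtype.ext ((ssyt_zero hl a.2).trans (ssyt_zero hl b.2).symm)⟩
    infer_instance
  | succ k ih =>
    intro lam hl hd
    have : ∀ nu : {nu : ℕ → ℕ // Intl k lam nu}, Finite {T : ℕ → ℕ → ℕ // IsSSYT k nu.1 T} :=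
      fun nu => ih nu.1 nu.2.2 nu.2.dom'
    exact Finite.of_equiv _ (ssytEquiv k lam hl hd).symm

theorem schur_zero (lam) (hl : Supp 0 lam) (r : ℕ → ℝ) : schur 0 lam r = 1 := by
  unfold schur
  have : Unique {T : ℕ → ℕ → ℕ // IsSSYT 0 lam T} :=
    { default := ⟨_, zero_ssyt hl⟩, uniq := fun a => Subtype.ext (ssyt_zero hl a.2) }
  simp

theorem schur_succ (k lam) (hl : Supp (k+1) lam) (hd : Dom lam) (r : ℕ → ℝ) :
    schur (k+1) lam r = ∑' nu : {nu : ℕ → ℕ // Intl k lam nu},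
      r k ^ (sz (k+1) lam - sz k nu.1) * schur k nu.1 r := by
  have : ∀ nu : {nu : ℕ → ℕ // Intl k lam nu}, Finite {T : ℕ → ℕ → ℕ // IsSSYT k nu.1 T} :=
    fun nu => finite_ssyt k nu.1 nu.2.2 nu.2.dom'
  unfold schur
  rw [← (ssytEquiv k lam hl hd).symm.tsum_eq]
  have e : ∀ a : (Σ nu : {nu : ℕ → ℕ // Intl k lam nu}, {T : ℕ → ℕ → ℕ // IsSSYT k nu.1 T}),
      ∏ i ∈ Finset.range (k+1),
        r i ^ entryCount (k+1) lam ((ssytEquiv k lam hl hd).symm a).1 i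
      = r k ^ (sz (k+1) lam - sz k a.1.1) *
        ∏ i ∈ Finset.range k, r i ^ entryCount k a.1.1 a.2.1 i := by
    intro a
    show ∏ i ∈ Finset.range (k+1), r i ^ entryCount (k+1) lam (glueT k lam a.1.1 a.2.1) i = _
    rw [Finset.prod_range_succ, count_glue_eq a.1.2 a.2.2, mul_comm]
    congr 1
    refine Finset.prod_congr rfl fun i hi => ?_
    rw [count_glue_lt a.1.2 i (Finset.mem_range.1 hi)]
  rw [tsum_congr e]
  have hfin : Finite (Σ nu : {nu : ℕ → ℕ // Intl k lam nu},
    {T : ℕ → ℕ → ℕ // IsSSYT k nu.1 T}) := inferInstance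
  rw [Summable.tsum_sigma' (fun _ => Summable.of_finite) Summable.of_finite]
  refine tsum_congr fun nu => ?_
  dsimp only
  rw [← tsum_mul_left]

theorem schur_pos (k : ℕ) (r : ℕ → ℝ) : ∀ lam, Supp k lam → Dom lam →
    (∀ i, i < k → 0 < r i) → 0 < schur k lam r := by
  induction k with
  | zero => intro lam hl _ _; rw [schur_zero lam hl]; exact one_pos
  | succ k ih =>
    intro lam hl hd hr
    rw [schur_succ k lam hl hd]
    have hpos : ∀ nu : {nu : ℕ → ℕ // Intl k lam nu},
        0 < r k ^ (sz (k+1) lam - sz k nu.1) * schur k nu.1 r := fun nu =>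
      mul_pos (pow_pos (hr k (by omega)) _)
        (ih nu.1 nu.2.2 nu.2.dom' (fun i hi => hr i (by omega)))
    refine Summable.tsum_pos Summable.of_finite (fun nu => (hpos nu).le)
      ⟨fun i => if i < k then lam i else 0, fun i hi => ?_, fun i hi => ?_⟩ (hpos _)
    · simp only [if_pos hi]; exact ⟨hd i, le_rfl⟩
    · exact if_neg (by omega)

open Classical in
noncomputable def FF (k : ℕ) (r : ℕ → ℝ) (lam : ℕ → ℕ) : ℝ :=
  if Dom lam then schur k lam r else 0

open Classical in
theorem FF_succ (k N : ℕ) (r : ℕ → ℝ) (lam) (hl : Supp (k+1) lam) (hN : lam 0 ≤ N) :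
    FF (k+1) r lam = ∑ nu ∈ box k N,
      if Intl k lam nu then r k ^ (sz (k+1) lam - sz k nu) * FF k r nu else 0 := by
  by_cases hd : Dom lam
  · rw [FF, if_pos hd, schur_succ k lam hl hd, ← Finset.sum_filter]
    have F1 := Fintype.ofFinite {nu : ℕ → ℕ // Intl k lam nu}
    rw [tsum_fintype]
    symm
    have e := Finset.sum_subtype (F := F1) (p := fun nu => Intl k lam nu)
      ((box k N).filter (fun nu => Intl k lam nu))
      (fun nu => by
        rw [Finset.mem_filter]
        exact ⟨fun h => h.2, fun h => ⟨h.mem_box hd hN, h⟩⟩)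
      (fun nu => r k ^ (sz (k+1) lam - sz k nu) * FF k r nu)
    rw [e]
    refine Finset.sum_congr rfl fun nu _ => ?_
    rw [FF, if_pos nu.2.dom']
  · rw [FF, if_neg hd, Finset.sum_eq_zero]
    intro nu _
    rw [if_neg (fun h => hd (h.dom hl))]

open Classical in
theorem count_id (k : ℕ) (lam ka : ℕ → ℕ) (hl : Dom lam) (hk : Dom ka) :
    (∑ j ∈ Finset.range (k+1), if Intl k (addE lam j) ka then (1:ℝ) else 0)
      = (if Intl k lam ka then (1:ℝ) else 0)
        + ∑ i ∈ Finset.range k, if (1 ≤ ka i ∧ Intl k lam (subE ka i)) then (1:ℝ) else 0 := by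
  by_cases h : Intl k lam ka
  · rw [Finset.sum_range_succ', if_pos h, add_comm]
    congr 1
    · rw [if_pos]
      refine ⟨fun i hi => ?_, h.2⟩
      have := h.1 i hi
      simp only [addE]
      constructor <;> (try split_ifs) <;> first | contradiction | omega
    · refine Finset.sum_congr rfl fun i hi => ?_
      rw [Finset.mem_range] at hi
      refine if_congr ?_ rfl rfl
      constructor
      · intro h1
        have a := h1.1 i hi
        simp only [addE, if_true] at a
        refine ⟨by omega, fun j hj => ?_, fun j hj => ?_⟩
        · have := h.1 j hj
          unfold subE
          split_ifs with e
          · subst e; omega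
          · omega
        · unfold subE
          rw [if_neg (by omega)]; exact h.2 j hj
      · rintro ⟨h1, h2⟩
        have a := h2.1 i hi
        simp only [subE, if_true] at a
        refine ⟨fun j hj => ?_, h.2⟩
        have := h.1 j hj
        unfold addE
        constructor
        · split_ifs with e
          · have : j = i := by omega
            subst this; omega
          · omega
        · split_ifs <;> omega
  · rw [Finset.sum_range_succ, if_neg h, zero_add, if_neg, add_zero]
    · refine Finset.sum_congr rfl fun i hi => ?_
      rw [Finset.mem_range] at hi
      refine if_congr ?_ rfl rfl
      constructor
      · intro h1
        have key : ka i = lam i + 1 := by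
          by_contra hne
          apply h
          refine ⟨fun j hj => ?_, h1.2⟩
          have b := h1.1 j hj
          unfold addE at b
          constructor
          · have := b.1; split_ifs at this <;> omega
          · have := b.2
            split_ifs at this with e
            · subst e; omega
            · omega
        refine ⟨by omega, fun j hj => ?_, fun j hj => ?_⟩
        · have b := h1.1 j hj
          unfold addE at b
          unfold subE
          have := hl j
          split_ifs at b ⊢ with e
          all_goals first | omega | (subst e; omega)
        · unfold subE
          rw [if_neg (by omega)]; exact h1.2 j hj
      · rintro ⟨h1, h2⟩
        have hs : Supp k ka := fun j hj => by
          have := h2.2 j hj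
          unfold subE at this
          rwa [if_neg (by omega)] at this
        have key : ka i = lam i + 1 := by
          by_contra hne
          apply h
          refine ⟨fun j hj => ?_, hs⟩
          have b := h2.1 j hj
          unfold subE at b
          split_ifs at b with e
          · subst e; omega
          · omega
        refine ⟨fun j hj => ?_, hs⟩
        have b := h2.1 j hj
        unfold subE at b
        unfold addE
        have := hk j
        constructor
        · by_cases e : j + 1 = i
          · rw [if_pos e]
            subst e
            omega
          · rw [if_neg e]
            split_ifs at b <;> omega
        · split_ifs at b ⊢ with e
          · subst e; omega
          · omega
    · intro h1
      apply h
      refine ⟨fun j hj => ?_, h1.2⟩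
      have b := h1.1 j hj
      unfold addE at b
      rw [if_neg (show j ≠ k by omega)] at b
      split_ifs at b <;> omega

theorem supp_addE {k lam i} (hl : Supp k lam) (hi : i < k) : Supp k (addE lam i) := by
  intro j hj
  unfold addE
  rw [if_neg (by omega)]; exact hl j hj

open Classical in
theorem pieri (k : ℕ) (r : ℕ → ℝ) : ∀ lam, Supp k lam → Dom lam →
    ∑ j ∈ Finset.range k, FF k r (addE lam j) = (∑ i ∈ Finset.range k, r i) * FF k r lam := by
  induction k with
  | zero => intro lam _ _; simp
  | succ k ih =>
    intro lam hl hd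
    set N := lam 0 + 1 with hN
    set w : (ℕ → ℕ) → ℝ := fun ka => r k ^ (sz (k+1) lam + 1 - sz k ka) * FF k r ka with hw
    have L : ∑ j ∈ Finset.range (k+1), FF (k+1) r (addE lam j)
        = ∑ ka ∈ box k N, (∑ j ∈ Finset.range (k+1),
            if Intl k (addE lam j) ka then (1:ℝ) else 0) * w ka := by
      simp only [Finset.sum_mul]
      rw [Finset.sum_comm]
      refine Finset.sum_congr rfl fun j hj => ?_
      rw [Finset.mem_range] at hj
      rw [FF_succ k N r _ (supp_addE hl hj) (by unfold addE; split_ifs <;> omega)]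
      refine Finset.sum_congr rfl fun ka _ => ?_
      rw [sz_addE hj]
      split_ifs <;> simp [hw]
    have R1 : r k * FF (k+1) r lam
        = ∑ ka ∈ box k N, (if Intl k lam ka then (1:ℝ) else 0) * w ka := by
      rw [FF_succ k N r _ hl (by omega), Finset.mul_sum]
      refine Finset.sum_congr rfl fun ka _ => ?_
      split_ifs with h
      · have := sz_le h
        rw [one_mul, hw]
        simp only
        rw [show sz (k+1) lam + 1 - sz k ka = (sz (k+1) lam - sz k ka) + 1 by omega, pow_succ]
        ring
      · simp
    have R2 : (∑ i ∈ Finset.range k, r i) * FF (k+1) r lam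
        = ∑ ka ∈ box k N, (∑ i ∈ Finset.range k,
          if (1 ≤ ka i ∧ Intl k lam (subE ka i)) then (1:ℝ) else 0) * w ka := by
      rw [FF_succ k N r _ hl (by omega), Finset.mul_sum]
      have : ∀ nu ∈ box k N, (∑ i ∈ Finset.range k, r i) *
          (if Intl k lam nu then r k ^ (sz (k+1) lam - sz k nu) * FF k r nu else 0)
          = ∑ i ∈ Finset.range k, if Intl k lam nu then w (addE nu i) else 0 := by
        intro nu _
        split_ifs with h
        · rw [mul_left_comm, ← ih nu h.2 h.dom', Finset.mul_sum]
          refine Finset.sum_congr rfl fun i hi => ?_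
          rw [hw]
          simp only
          rw [sz_addE (Finset.mem_range.1 hi), Nat.add_sub_add_right]
        · simp
      rw [Finset.sum_congr rfl this]
      simp only [Finset.sum_mul]
      rw [Finset.sum_comm, Finset.sum_comm (s := box k N)]
      refine Finset.sum_congr rfl fun i hi => ?_
      rw [Finset.mem_range] at hi
      simp only [ite_mul, one_mul, zero_mul]
      rw [← Finset.sum_filter, ← Finset.sum_filter]
      refine Finset.sum_nbij' (fun nu => addE nu i) (fun ka => subE ka i) ?_ ?_ ?_ ?_ ?_
      · intro nu h
        rw [Finset.mem_filter] at h ⊢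
        refine ⟨mem_box.2 ⟨fun j => ?_, supp_addE h.2.2 hi⟩, ?_, ?_⟩
        · have := h.2.le j
          have := hd.anti (Nat.zero_le j)
          unfold addE
          split_ifs <;> omega
        · simp [addE]
        · rw [subE_addE]; exact h.2
      · intro ka h
        rw [Finset.mem_filter] at h ⊢
        exact ⟨h.2.2.mem_box hd (by omega), h.2.2⟩
      · intro nu _; exact subE_addE
      · intro ka h
        rw [Finset.mem_filter] at h
        exact addE_subE h.2.1
      · intro nu _; rfl
    rw [Finset.sum_range_succ (f := r), add_mul, L, R1, R2, ← Finset.sum_add_distrib]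
    refine Finset.sum_congr rfl fun ka _ => ?_
    by_cases hk : Dom ka
    · rw [count_id k lam ka hd hk]; ring
    · have : w ka = 0 := by rw [hw]; simp [FF, hk]
      simp [this]

theorem supp_rev (k x) : Supp k (revPart k x) := by
  intro i hi
  unfold revPart
  rw [if_neg (by omega)]

theorem dom_rev (k : ℕ) (x : ℕ → ℕ) :
    Dom (revPart k x) ↔ ∀ i, i + 1 < k → x i ≤ x (i+1) := by
  constructor
  · intro h i hi
    have := h (k - 1 - (i+1))
    unfold revPart at this
    rw [if_pos (by omega), if_pos (by omega),
      show k - 1 - (k - 1 - (i+1) + 1) = i by omega,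
      show k - 1 - (k - 1 - (i+1)) = i + 1 by omega] at this
    exact this
  · intro h i
    unfold revPart
    by_cases hi : i + 1 < k
    · rw [if_pos hi, if_pos (by omega)]
      have := h (k - 1 - (i+1)) (by omega)
      rw [show k - 1 - (i+1) + 1 = k - 1 - i by omega] at this
      exact this
    · rw [if_neg hi]; omega

theorem hr_eq (k p r x) : hrFun k p r x
    = (∏ i ∈ Finset.range k, (p i)⁻¹ ^ x i) * FF k r (revPart k x) := by
  unfold hrFun FF
  by_cases h : Dom (revPart k x)
  · rw [if_pos h, if_pos ((dom_rev k x).1 h)]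
  · rw [if_neg h, if_neg (fun h' => h ((dom_rev k x).2 h')), mul_zero]

theorem rev_addE (k x i) (hi : i < k) :
    revPart k (addE x i) = addE (revPart k x) (k - 1 - i) := by
  funext j
  unfold revPart addE
  by_cases hj : j < k
  · simp only [if_pos hj]
    by_cases e : k - 1 - j = i
    · rw [if_pos e, if_pos (by omega)]
    · rw [if_neg e, if_neg (by omega)]
  · simp only [if_neg hj]
    rw [if_neg (by omega)]

/-- `h_r` is harmonic on `W ∩ ℤ_+^k` for the kernel
`P(x,y) = p^{y-x} 1_{y-x ∈ {e_1,…,e_k}}`, and is strictly positive on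
`W ∩ ℤ_+^k` when all `r_i > 0`. -/
theorem stmt9 (k : ℕ) (hk : 1 ≤ k) (p r : ℕ → ℝ)
    (hp : ∀ i, i < k → 0 < p i)
    (hr0 : ∀ i, i < k → 0 ≤ r i)
    (hrsum : ∑ i ∈ Finset.range k, r i = 1)
    (x : ℕ → ℕ) (hxW : ∀ i, i + 1 < k → x i ≤ x (i+1)) :
    (∑ i ∈ Finset.range k,
        p i * hrFun k p r (fun j => if j = i then x j + 1 else x j))
      = hrFun k p r x
    ∧ ((∀ i, i < k → 0 < r i) → 0 < hrFun k p r x) := by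
  have step : ∀ i ∈ Finset.range k,
      p i * hrFun k p r (fun j => if j = i then x j + 1 else x j)
        = (∏ i ∈ Finset.range k, (p i)⁻¹ ^ x i) * FF k r (addE (revPart k x) (k - 1 - i)) := by
    intro i hi
    have hik := Finset.mem_range.1 hi
    show p i * hrFun k p r (addE x i) = _
    rw [hr_eq, rev_addE k x i hik, ← mul_assoc]
    congr 1
    rw [← Finset.mul_prod_erase _ _ hi, ← Finset.mul_prod_erase (Finset.range k) _ hi]
    have e : ∏ j ∈ (Finset.range k).erase i, (p j)⁻¹ ^ addE x i j
        = ∏ j ∈ (Finset.range k).erase i, (p j)⁻¹ ^ x j := by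
      refine Finset.prod_congr rfl fun j hj => ?_
      have := Finset.ne_of_mem_erase hj
      simp [addE, this]
    rw [e]
    have hpi : p i ≠ 0 := (hp i hik).ne'
    simp only [addE, if_true]
    rw [pow_succ]
    field_simp
  have hdom := (dom_rev k x).2 hxW
  refine ⟨?_, fun hr => ?_⟩
  · rw [Finset.sum_congr rfl step, ← Finset.mul_sum,
      Finset.sum_range_reflect (fun i => FF k r (addE (revPart k x) i)) k,
      pieri k r _ (supp_rev k x) hdom, hrsum, one_mul, hr_eq]
  · rw [hr_eq]
    refine mul_pos (Finset.prod_pos fun i hi => ?_) ?_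
    · exact pow_pos (inv_pos.2 (hp i (Finset.mem_range.1 hi))) _
    · rw [FF, if_pos hdom]
      exact schur_pos k r _ (supp_rev k x) hdom hr
end

section
/- Sup-integration-by-parts (max-plus) formula: let u,v:[0,∞)→ℝ be continuous with u(0)=v(0)=0, and let t>0. Then max( sup_{0<s<t}[ sup_{0<r<s} u(r) + v(s) ], sup_{0<s<t}[ u(s) + sup_{0<r<s} v(r) ] ) = sup_{0<s<t} u(s) + sup_{0<s<t} v(s). -/
theorem aux_bdd (u : ℝ → ℝ) (hu : ContinuousOn u (Set.Ici 0)) (s : ℝ) :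
    BddAbove (u '' Set.Ioo 0 s) :=
  ((isCompact_Icc (a := (0:ℝ)) (b := s)).bddAbove_image
    (hu.mono fun _ hx => hx.1)).mono (Set.image_mono Set.Ioo_subset_Icc_self)

theorem aux_le (u : ℝ → ℝ) (hu : ContinuousOn u (Set.Ici 0)) (a s : ℝ) (ha : 0 < a)
    (has : a ≤ s) : u a ≤ sSup (u '' Set.Ioo 0 s) := by
  have h1 : Filter.Tendsto u (nhdsWithin a (Set.Iio a)) (nhds (u a)) :=
    (hu.continuousAt (Ici_mem_nhds ha)).tendsto.mono_left nhdsWithin_le_nhds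
  refine le_of_tendsto h1 ?_
  filter_upwards [Ioo_mem_nhdsLT ha] with x hx
  exact le_csSup (aux_bdd u hu s) ⟨x, ⟨hx.1, hx.2.trans_le has⟩, rfl⟩

theorem aux_mono (u : ℝ → ℝ) (hu : ContinuousOn u (Set.Ici 0)) (s t : ℝ) (hs : 0 < s)
    (hst : s ≤ t) : sSup (u '' Set.Ioo 0 s) ≤ sSup (u '' Set.Ioo 0 t) :=
  csSup_le_csSup (aux_bdd u hu t) ((Set.nonempty_Ioo.2 hs).image u)
    (Set.image_mono (Set.Ioo_subset_Ioo_right hst))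

/-- sup-integration-by-parts, max-plus formula: for continuous
`u, v` on `[0,∞)` with `u(0)=v(0)=0` and `t > 0`,
`max(sup_{0<s<t}[sup_{0<r<s} u(r) + v(s)], sup_{0<s<t}[u(s) + sup_{0<r<s} v(r)])
  = sup_{0<s<t} u(s) + sup_{0<s<t} v(s)`. -/
theorem stmt18 (u v : ℝ → ℝ)
    (hu : ContinuousOn u (Set.Ici 0)) (hv : ContinuousOn v (Set.Ici 0))
    (hu0 : u 0 = 0) (hv0 : v 0 = 0) (t : ℝ) (ht : 0 < t) :
    max (sSup ((fun s => sSup (u '' Set.Ioo 0 s) + v s) '' Set.Ioo 0 t))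
        (sSup ((fun s => u s + sSup (v '' Set.Ioo 0 s)) '' Set.Ioo 0 t))
      = sSup (u '' Set.Ioo 0 t) + sSup (v '' Set.Ioo 0 t) := by
  have hne : (Set.Ioo 0 t).Nonempty := Set.nonempty_Ioo.2 ht
  have h1 : ∀ y ∈ (fun s => sSup (u '' Set.Ioo 0 s) + v s) '' Set.Ioo 0 t,
      y ≤ sSup (u '' Set.Ioo 0 t) + sSup (v '' Set.Ioo 0 t) := by
    rintro _ ⟨s, hs, rfl⟩
    exact add_le_add (aux_mono u hu s t hs.1 hs.2.le) (aux_le v hv s t hs.1 hs.2.le)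
  have h2 : ∀ y ∈ (fun s => u s + sSup (v '' Set.Ioo 0 s)) '' Set.Ioo 0 t,
      y ≤ sSup (u '' Set.Ioo 0 t) + sSup (v '' Set.Ioo 0 t) := by
    rintro _ ⟨s, hs, rfl⟩
    exact add_le_add (aux_le u hu s t hs.1 hs.2.le) (aux_mono v hv s t hs.1 hs.2.le)
  apply le_antisymm
  · exact max_le (csSup_le (hne.image _) h1) (csSup_le (hne.image _) h2)
  · rw [← le_sub_iff_add_le]
    apply csSup_le (hne.image _)
    rintro _ ⟨a, ha, rfl⟩
    rw [le_sub_comm]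
    apply csSup_le (hne.image _)
    rintro _ ⟨b, hb, rfl⟩
    rw [le_sub_iff_add_le']
    rcases le_total a b with hab | hab
    · refine le_trans ?_ (le_max_left _ _)
      exact (add_le_add (aux_le u hu a b ha.1 hab) le_rfl).trans
        (le_csSup ⟨_, h1⟩ ⟨b, hb, rfl⟩)
    · refine le_trans ?_ (le_max_right _ _)
      exact (add_le_add le_rfl (aux_le v hv b a hb.1 hab)).trans
        (le_csSup ⟨_, h2⟩ ⟨a, ha, rfl⟩)
end
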